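/- Let v^L be a positive solution on Ω with ∫_{C^L} |∇v^L|² < +∞ and let v^R be a positive solution on Ω with ∫_{C^R} |∇v^R|² < +∞. Then every positive solution w on Ω is of the form w = c^L v^L + c^R v^R for constants c^L, c^R ≥ 0, at least one of which is nonzero. -/

import Mathlib

open MeasureTheory Filter Set

noncomputable section

/-- Second directional derivative of `u` at `z` in the direction `w`. -/
def dd2 {d : ℕ} (u : ℝ × (Fin (d+1) → ℝ) → ℝ) (w z : ℝ × (Fin (d+1) → ℝ)) : ℝ :=
  fderiv ℝ (fun z' => fderiv ℝ u z' w) z w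

/-- The Laplacian on `ℝ × ℝ^{N-1}`: sum of the pure second partial derivatives. -/
def lap {d : ℕ} (u : ℝ × (Fin (d+1) → ℝ) → ℝ) (z : ℝ × (Fin (d+1) → ℝ)) : ℝ :=
  dd2 u (1, 0) z + ∑ i : Fin (d+1), dd2 u (0, Pi.single i 1) z

/-- `|∇u|²`, the squared norm of the gradient. -/
def gradSq {d : ℕ} (u : ℝ × (Fin (d+1) → ℝ) → ℝ) (z : ℝ × (Fin (d+1) → ℝ)) : ℝ :=
  (fderiv ℝ u z (1, 0))^2 + ∑ i : Fin (d+1), (fderiv ℝ u z (0, Pi.single i 1))^2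

/-- The Laplacian on `ℝ^{N-1}`. -/
def lapU {d : ℕ} (ψ : (Fin (d+1) → ℝ) → ℝ) (y : Fin (d+1) → ℝ) : ℝ :=
  ∑ i : Fin (d+1), fderiv ℝ (fun y' => fderiv ℝ ψ y' (Pi.single i 1)) y (Pi.single i 1)

/-- `U` has smooth boundary: it is the sublevel set of a smooth function with
nonvanishing differential on the boundary. -/
def HasSmoothBoundary {d : ℕ} (U : Set (Fin (d+1) → ℝ)) : Prop :=
  ∃ f : (Fin (d+1) → ℝ) → ℝ, ContDiff ℝ (⊤ : ℕ∞) f ∧ U = {y | f y < 0} ∧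
    ∀ y ∈ frontier U, fderiv ℝ f y ≠ 0

/-- The set of Dirichlet eigenfunctions of `-Δ` on `U` for the value `lam`
(including the zero function). -/
def eigSet {d : ℕ} (U : Set (Fin (d+1) → ℝ)) (lam : ℝ) : Set ((Fin (d+1) → ℝ) → ℝ) :=
  {ψ | ContinuousOn ψ (closure U) ∧ ContDiffOn ℝ 2 ψ U ∧
    (∀ y ∈ U, lapU ψ y = -(lam * ψ y)) ∧ (∀ y ∈ frontier U, ψ y = 0)}

/-- `lam` is a Dirichlet eigenvalue of `-Δ` on `U`. -/
def IsDirichletEigenvalue {d : ℕ} (U : Set (Fin (d+1) → ℝ)) (lam : ℝ) : Prop :=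
  ∃ ψ ∈ eigSet U lam, ∃ y ∈ U, ψ y ≠ 0

/-- The domain `Ω = C^L ∪ C^R ∪ Γ`. -/
def OmegaSet {d : ℕ} (UL UR : Set (Fin (d+1) → ℝ)) : Set (ℝ × (Fin (d+1) → ℝ)) :=
  {z | (z.1 < 0 ∧ z.2 ∈ UL) ∨ (0 < z.1 ∧ z.2 ∈ UR) ∨ (z.1 = 0 ∧ z.2 ∈ UL ∩ UR)}

/-- A solution of the Dirichlet problem on `Ω`. -/
def IsSolution {d : ℕ} (UL UR : Set (Fin (d+1) → ℝ)) (u : ℝ × (Fin (d+1) → ℝ) → ℝ) : Prop :=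
  ContinuousOn u (closure (OmegaSet UL UR)) ∧
  ContDiffOn ℝ 1 u (OmegaSet UL UR) ∧
  ContDiffOn ℝ 2 u (OmegaSet UL UR) ∧
  (∀ z ∈ OmegaSet UL UR, lap u z = 0) ∧
  (∀ z ∈ frontier (OmegaSet UL UR), u z = 0)

/-- The Almgren frequency function `N(u)(x)`. -/
def freq {d : ℕ} (UL UR : Set (Fin (d+1) → ℝ)) (u : ℝ × (Fin (d+1) → ℝ) → ℝ) (x : ℝ) : ℝ :=
  if 0 < x then
    (∫ z in {z ∈ OmegaSet UL UR | 0 < z.1 ∧ z.1 < x}, gradSq u z) /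
      (∫ y in UR, (u (x, y))^2)
  else
    (∫ z in {z ∈ OmegaSet UL UR | x < z.1 ∧ z.1 < 0}, gradSq u z) /
      (∫ y in UL, (u (x, y))^2)

/-- The left chamber `C^L`. -/
def CLset {d : ℕ} (UL : Set (Fin (d+1) → ℝ)) : Set (ℝ × (Fin (d+1) → ℝ)) :=
  {z | z.1 < 0 ∧ z.2 ∈ UL}

/-- The right chamber `C^R`. -/
def CRset {d : ℕ} (UR : Set (Fin (d+1) → ℝ)) : Set (ℝ × (Fin (d+1) → ℝ)) :=
  {z | 0 < z.1 ∧ z.2 ∈ UR}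

/-- Points of `ℝ × ℝ^{N-1}`. -/
abbrev Pt (d : ℕ) := ℝ × (Fin (d+1) → ℝ)

/-- The coordinate directions of `ℝ × ℝ^{N-1}`. -/
def dirs {d : ℕ} : Option (Fin (d+1)) → Pt d := fun o => o.elim (1, 0) fun i => (0, Pi.single i 1)

/-- The coordinates of a point of `ℝ × ℝ^{N-1}`. -/
def coord {d : ℕ} (o : Option (Fin (d+1))) : Pt d →L[ℝ] ℝ :=
  o.elim (ContinuousLinearMap.fst ℝ ℝ _) fun i =>
    (ContinuousLinearMap.proj i).comp (ContinuousLinearMap.snd ℝ ℝ _)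

section Calculus

variable {d : ℕ} {u v g : Pt d → ℝ} {w z : Pt d} {φ φ₁ : ℝ → ℝ} {c : ℝ}

lemma lap_eq_sum (u : Pt d → ℝ) (z : Pt d) : lap u z = ∑ o, dd2 u (dirs o) z := by
  simp [lap, dirs, Fintype.sum_option]

lemma gradSq_eq_sum (u : Pt d → ℝ) (z : Pt d) :
    gradSq u z = ∑ o, (fderiv ℝ u z (dirs o)) ^ 2 := by
  simp [gradSq, dirs, Fintype.sum_option]

lemma sum_coord_smul_dirs (z : Pt d) : ∑ o, coord o z • dirs o = z := by
  have h : ∑ i, z.2 i • (Pi.single i 1 : Fin (d+1) → ℝ) = z.2 := by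
    ext j
    simp [Finset.sum_apply, Pi.single_apply]
  have h0 : (∑ i, z.2 i • ((0, Pi.single i 1) : Pt d)) = (0, z.2) := by
    refine Prod.ext ?_ ?_
    · simp [Prod.fst_sum]
    · simpa [Prod.snd_sum] using h
  rw [Fintype.sum_option]
  simp only [coord, dirs, Option.elim, ContinuousLinearMap.comp_apply, ContinuousLinearMap.coe_fst',
    ContinuousLinearMap.coe_snd', ContinuousLinearMap.proj_apply]
  rw [h0]
  simp

lemma clm_apply_eq_sum (L : Pt d →L[ℝ] ℝ) (z : Pt d) : L z = ∑ o, coord o z * L (dirs o) := by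
  conv_lhs => rw [← sum_coord_smul_dirs z]
  simp only [map_sum, map_smul, smul_eq_mul]

lemma gradSq_nonneg (u : Pt d → ℝ) (z : Pt d) : 0 ≤ gradSq u z := by
  rw [gradSq_eq_sum]; positivity

lemma differentiableAt_fderiv_apply (hu : ContDiffAt ℝ 2 u z) (w : Pt d) :
    DifferentiableAt ℝ (fun z' => fderiv ℝ u z' w) z := by
  have h : ContDiffAt ℝ 1 (fderiv ℝ u) z := hu.fderiv_right (by norm_num)
  exact (h.differentiableAt one_ne_zero).clm_apply (differentiableAt_const w)

lemma eventually_differentiableAt (hu : ContDiffAt ℝ 2 u z) :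
    ∀ᶠ z' in nhds z, DifferentiableAt ℝ u z' :=
  (hu.eventually (by simp)).mono fun _ h => h.differentiableAt (by norm_num)

lemma dd2_congr (h : u =ᶠ[nhds z] v) (w : Pt d) : dd2 u w z = dd2 v w z := by
  have h1 : (fun z' => fderiv ℝ u z' w) =ᶠ[nhds z] fun z' => fderiv ℝ v z' w := by
    filter_upwards [h.fderiv (𝕜 := ℝ)] with z' hz'
    rw [hz']
  simp only [dd2, h1.fderiv_eq]

lemma lap_congr (h : u =ᶠ[nhds z] v) : lap u z = lap v z := by
  simp only [lap_eq_sum, dd2_congr h]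

lemma dd2_add (hu : ContDiffAt ℝ 2 u z) (hv : ContDiffAt ℝ 2 v z) :
    dd2 (fun z => u z + v z) w z = dd2 u w z + dd2 v w z := by
  have h1 : (fun z' => fderiv ℝ (fun z => u z + v z) z' w) =ᶠ[nhds z]
      fun z' => fderiv ℝ u z' w + fderiv ℝ v z' w := by
    filter_upwards [eventually_differentiableAt hu, eventually_differentiableAt hv] with z' h1 h2
    rw [fderiv_fun_add h1 h2]; rfl
  simp only [dd2, h1.fderiv_eq]
  rw [fderiv_fun_add (differentiableAt_fderiv_apply hu w) (differentiableAt_fderiv_apply hv w)]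
  rfl

lemma lap_add (hu : ContDiffAt ℝ 2 u z) (hv : ContDiffAt ℝ 2 v z) :
    lap (fun z => u z + v z) z = lap u z + lap v z := by
  simp only [lap_eq_sum, dd2_add hu hv, Finset.sum_add_distrib]

lemma fderiv_mul_apply (hu : DifferentiableAt ℝ u z) (hv : DifferentiableAt ℝ v z) (w : Pt d) :
    fderiv ℝ (fun z => u z * v z) z w = u z * fderiv ℝ v z w + v z * fderiv ℝ u z w := by
  rw [fderiv_fun_mul hu hv]; simp

lemma dd2_mul (hu : ContDiffAt ℝ 2 u z) (hv : ContDiffAt ℝ 2 v z) :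
    dd2 (fun z => u z * v z) w z =
      u z * dd2 v w z + 2 * (fderiv ℝ u z w * fderiv ℝ v z w) + v z * dd2 u w z := by
  have h1 : (fun z' => fderiv ℝ (fun z => u z * v z) z' w) =ᶠ[nhds z]
      fun z' => u z' * fderiv ℝ v z' w + v z' * fderiv ℝ u z' w := by
    filter_upwards [eventually_differentiableAt hu, eventually_differentiableAt hv] with z' h1 h2
    exact fderiv_mul_apply h1 h2 w
  have hu1 := eventually_differentiableAt hu |>.self_of_nhds
  have hv1 := eventually_differentiableAt hv |>.self_of_nhds
  have hu2 := differentiableAt_fderiv_apply hu w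
  have hv2 := differentiableAt_fderiv_apply hv w
  simp only [dd2, h1.fderiv_eq]
  rw [fderiv_fun_add (hu1.fun_mul hv2) (hv1.fun_mul hu2), add_apply,
    fderiv_mul_apply hu1 hv2, fderiv_mul_apply hv1 hu2]
  ring

lemma dd2_const (c : ℝ) (w z : Pt d) : dd2 (fun _ => c) w z = 0 := by
  simp [dd2]

lemma lap_const (c : ℝ) (z : Pt d) : lap (fun _ => c) z = 0 := by
  simp [lap_eq_sum, dd2_const]

lemma lap_const_mul (hu : ContDiffAt ℝ 2 u z) : lap (fun z => c * u z) z = c * lap u z := by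
  simp only [lap_eq_sum, dd2_mul (u := fun _ => c) contDiffAt_const hu, dd2_const, Finset.mul_sum]
  simp

lemma lap_sub (hu : ContDiffAt ℝ 2 u z) (hv : ContDiffAt ℝ 2 v z) :
    lap (fun z => u z - v z) z = lap u z - lap v z := by
  have h : (fun z => u z - v z) = fun z => u z + (-1) * v z := by ext; ring
  rw [h, lap_add hu (contDiffAt_const.mul hv), lap_const_mul hv]; ring

lemma fderiv_comp_apply (hg : DifferentiableAt ℝ g z) (hφ : HasDerivAt φ c (g z)) (w : Pt d) :
    fderiv ℝ (fun z => φ (g z)) z w = c * fderiv ℝ g z w := by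
  have := hφ.comp_hasFDerivAt z hg.hasFDerivAt
  rw [show (fun z => φ (g z)) = φ ∘ g from rfl, this.fderiv]; simp

lemma dd2_comp (hg : ContDiffAt ℝ 2 g z) (hφ : ∀ t, HasDerivAt φ (φ₁ t) t)
    (hφ₁ : HasDerivAt φ₁ c (g z)) :
    dd2 (fun z => φ (g z)) w z = c * (fderiv ℝ g z w) ^ 2 + φ₁ (g z) * dd2 g w z := by
  have h1 : (fun z' => fderiv ℝ (fun z => φ (g z)) z' w) =ᶠ[nhds z]
      fun z' => φ₁ (g z') * fderiv ℝ g z' w := by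
    filter_upwards [eventually_differentiableAt hg] with z' h1
    exact fderiv_comp_apply h1 (hφ _) w
  have hg1 := eventually_differentiableAt hg |>.self_of_nhds
  have hg2 := differentiableAt_fderiv_apply hg w
  have h3 : DifferentiableAt ℝ (fun z => φ₁ (g z)) z :=
    DifferentiableAt.comp z hφ₁.differentiableAt hg1
  simp only [dd2, h1.fderiv_eq]
  rw [fderiv_mul_apply h3 hg2, fderiv_comp_apply hg1 hφ₁]
  ring

lemma lap_comp (hg : ContDiffAt ℝ 2 g z) (hφ : ∀ t, HasDerivAt φ (φ₁ t) t)
    (hφ₁ : HasDerivAt φ₁ c (g z)) :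
    lap (fun z => φ (g z)) z = c * gradSq g z + φ₁ (g z) * lap g z := by
  simp only [lap_eq_sum, gradSq_eq_sum, dd2_comp hg hφ hφ₁, Finset.sum_add_distrib, Finset.mul_sum]

lemma fderiv_comp_add (u : Pt d → ℝ) (a z : Pt d) :
    fderiv ℝ (fun z => u (z + a)) z = fderiv ℝ u (z + a) :=
  fderiv_comp_add_right a

lemma dd2_comp_add (u : Pt d → ℝ) (a z w : Pt d) :
    dd2 (fun z => u (z + a)) w z = dd2 u w (z + a) := by
  simp only [dd2, fderiv_comp_add]
  rw [fderiv_comp_add (fun z => fderiv ℝ u z w) a z]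

lemma lap_comp_add (u : Pt d → ℝ) (a z : Pt d) : lap (fun z => u (z + a)) z = lap u (z + a) := by
  simp only [lap_eq_sum, dd2_comp_add]

lemma gradSq_comp_add (u : Pt d → ℝ) (a z : Pt d) :
    gradSq (fun z => u (z + a)) z = gradSq u (z + a) := by
  simp only [gradSq_eq_sum, fderiv_comp_add]

/-- The reflection `(x, y) ↦ (-x, y)`. -/
def mirror (d : ℕ) : Pt d ≃L[ℝ] Pt d :=
  (ContinuousLinearEquiv.neg ℝ).prodCongr (ContinuousLinearEquiv.refl ℝ _)

@[simp] lemma mirror_apply (z : Pt d) : mirror d z = (-z.1, z.2) := rfl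

lemma fderiv_comp_mirror (u : Pt d → ℝ) (z w : Pt d) :
    fderiv ℝ (fun z => u (mirror d z)) z w = fderiv ℝ u (mirror d z) (mirror d w) := by
  have := (mirror d).comp_right_fderiv (f := u) (x := z)
  rw [show (fun z => u (mirror d z)) = u ∘ mirror d from rfl, this]; rfl

lemma dd2_comp_mirror (u : Pt d → ℝ) (z w : Pt d) :
    dd2 (fun z => u (mirror d z)) w z = dd2 u (mirror d w) (mirror d z) := by
  simp only [dd2, fderiv_comp_mirror]
  rw [fderiv_comp_mirror (fun z => fderiv ℝ u z (mirror d w)) z w]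

lemma dd2_neg_dir (u : Pt d → ℝ) (z w : Pt d) : dd2 u (-w) z = dd2 u w z := by
  have : (fun z' => fderiv ℝ u z' (-w)) = fun z' => -fderiv ℝ u z' w := by ext; simp
  simp only [dd2, this]
  rw [fderiv_fun_neg]; simp

lemma mirror_dirs_none : mirror d (dirs none) = -dirs none := by simp [dirs]

lemma mirror_dirs_some (i : Fin (d+1)) : mirror d (dirs (some i)) = dirs (some i) := by simp [dirs]

lemma lap_comp_mirror (u : Pt d → ℝ) (z : Pt d) :
    lap (fun z => u (mirror d z)) z = lap u (mirror d z) := by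
  simp only [lap_eq_sum, dd2_comp_mirror, Fintype.sum_option, mirror_dirs_none, mirror_dirs_some,
    dd2_neg_dir]

lemma gradSq_comp_mirror (u : Pt d → ℝ) (z : Pt d) :
    gradSq (fun z => u (mirror d z)) z = gradSq u (mirror d z) := by
  simp only [gradSq_eq_sum, fderiv_comp_mirror, Fintype.sum_option, mirror_dirs_none, mirror_dirs_some,
    map_neg, neg_sq]

end Calculus

section MaximumPrinciple

variable {d : ℕ} {u h : Pt d → ℝ} {z : Pt d} {D : Set (Pt d)}

lemma dd2_nonpos_of_isLocalMax (hu : ContDiffAt ℝ 2 u z) (hm : IsLocalMax u z) (w : Pt d) :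
    dd2 u w z ≤ 0 := by
  by_contra! hpos
  have hline : ∀ t : ℝ, HasDerivAt (fun t : ℝ => z + t • w) w t := fun t => by
    simpa using ((hasDerivAt_id t).smul_const w).const_add z
  have hz0 : z + (0:ℝ) • w = z := by simp
  have htend : Tendsto (fun t : ℝ => z + t • w) (nhds 0) (nhds z) := by
    have : Continuous fun t : ℝ => z + t • w := by fun_prop
    simpa using this.tendsto 0
  have h1 : deriv (fun t : ℝ => u (z + t • w)) =ᶠ[nhds 0] fun t => fderiv ℝ u (z + t • w) w := by
    filter_upwards [htend.eventually (eventually_differentiableAt hu)] with t ht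
    exact (ht.hasFDerivAt.comp_hasDerivAt t (hline t)).deriv
  have h2 : deriv (deriv fun t : ℝ => u (z + t • w)) 0 = dd2 u w z := by
    rw [h1.deriv_eq]
    have hd := differentiableAt_fderiv_apply hu w
    rw [← hz0] at hd
    have := (hd.hasFDerivAt.comp_hasDerivAt (0:ℝ) (hline 0)).deriv
    rw [hz0] at this
    exact this
  have hm' : IsLocalMax (fun t : ℝ => u (z + t • w)) 0 := by
    have := htend.eventually hm
    filter_upwards [this] with t ht
    simpa using ht
  have hmin := isLocalMin_of_deriv_deriv_pos (f := fun t : ℝ => u (z + t • w)) (x₀ := 0)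
    (by rw [h2]; exact hpos) hm'.deriv_eq_zero
    (by
      have hc : ContinuousAt u (z + (0:ℝ) • w) := by rw [hz0]; exact hu.continuousAt
      exact ContinuousAt.comp hc (hline 0).continuousAt)
  have hconst : (fun t : ℝ => u (z + t • w)) =ᶠ[nhds 0] fun _ => u z := by
    filter_upwards [hm', hmin] with t h1 h2
    simp only [zero_smul, add_zero] at h1 h2
    exact le_antisymm h1 h2
  have : deriv (deriv fun t : ℝ => u (z + t • w)) 0 = 0 := by
    rw [hconst.deriv.deriv_eq]; simp
  rw [h2] at this
  linarith

lemma lap_fst_sq (z : Pt d) : lap (fun z : Pt d => z.1 ^ 2) z = 2 := by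
  have h1 : ∀ z w : Pt d, fderiv ℝ (fun z : Pt d => z.1 ^ 2) z w = 2 * z.1 * w.1 := by
    intro z w
    have : HasFDerivAt (fun z : Pt d => z.1 ^ 2) _ z := (hasFDerivAt_fst (𝕜 := ℝ)).pow 2
    rw [this.fderiv]; simp
  have h2 : ∀ w : Pt d, dd2 (fun z : Pt d => z.1 ^ 2) w z = 2 * w.1 * w.1 := by
    intro w
    simp only [dd2, h1]
    have : HasFDerivAt (fun z : Pt d => 2 * z.1 * w.1) _ z :=
      ((hasFDerivAt_fst (𝕜 := ℝ)).const_mul 2).mul_const w.1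
    rw [this.fderiv]; simp; ring
  simp [lap_eq_sum, h2, Fintype.sum_option, dirs]

/-- The weak maximum principle for subharmonic functions on bounded open sets. -/
theorem nonpos_of_subharmonic (hDo : IsOpen D) (hDb : Bornology.IsBounded D)
    (hc : ContinuousOn h (closure D)) (hC : ∀ z ∈ D, ContDiffAt ℝ 2 h z)
    (hl : ∀ z ∈ D, 0 ≤ lap h z) (hb : ∀ z ∈ frontier D, h z ≤ 0) : ∀ z ∈ D, h z ≤ 0 := by
  by_contra! hcon
  obtain ⟨z0, hz0, hpos⟩ := hcon
  have hK : IsCompact (closure D) := hDb.isCompact_closure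
  obtain ⟨M, hM⟩ := hK.exists_bound_of_continuousOn (f := fun z : Pt d => z.1 ^ 2)
    (by fun_prop)
  have hM0 : 0 ≤ M := (norm_nonneg _).trans (hM z0 (subset_closure hz0))
  set ε := h z0 / (2 * (M + 1)) with hε
  have hεpos : 0 < ε := by positivity
  have hεM : ε * M < h z0 := by
    have : ε * (2 * (M + 1)) = h z0 := by rw [hε]; field_simp
    nlinarith
  have hkc : ContinuousOn (fun z => h z + ε * z.1 ^ 2) (closure D) := by fun_prop
  obtain ⟨z1, hz1, hmax⟩ := hK.exists_isMaxOn ⟨z0, subset_closure hz0⟩ hkc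
  have hz1D : z1 ∈ D := by
    by_contra hn
    have hf : z1 ∈ frontier D := ⟨hz1, by rwa [hDo.interior_eq]⟩
    have h1 := hb z1 hf
    have h2 : h z0 + ε * z0.1 ^ 2 ≤ h z1 + ε * z1.1 ^ 2 := hmax (subset_closure hz0)
    have h3 : z1.1 ^ 2 ≤ M := (le_abs_self _).trans (hM z1 hz1)
    have h4 : 0 ≤ ε * z0.1 ^ 2 := by positivity
    nlinarith
  have hloc : IsLocalMax (fun z => h z + ε * z.1 ^ 2) z1 := by
    filter_upwards [hDo.mem_nhds hz1D] with z hz using hmax (subset_closure hz)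
  have hq : ContDiffAt ℝ 2 (fun z : Pt d => z.1 ^ 2) z1 := by fun_prop
  have hk : ContDiffAt ℝ 2 (fun z => h z + ε * z.1 ^ 2) z1 :=
    (hC z1 hz1D).add (contDiffAt_const.mul hq)
  have hle : lap (fun z => h z + ε * z.1 ^ 2) z1 ≤ 0 := by
    rw [lap_eq_sum]
    exact Finset.sum_nonpos fun o _ => dd2_nonpos_of_isLocalMax hk hloc _
  rw [lap_add (hC z1 hz1D) (contDiffAt_const.mul hq), lap_const_mul hq, lap_fst_sq] at hle
  have := hl z1 hz1D
  linarith

end MaximumPrinciple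

section Cutoffs

variable {ε t : ℝ}

/-- A smooth monotone cutoff, `0` on `(-∞, ε]` and `1` on `[2ε, ∞)`. -/
def cut (ε t : ℝ) : ℝ := Real.smoothTransition (t / ε - 1)

/-- The primitive of `cut ε`, a smooth convex approximation of the positive part. -/
def ramp (ε t : ℝ) : ℝ := ∫ s in (0:ℝ)..t, cut ε s

/-- The primitive of `ramp ε`, a smooth convex approximation of half the squared positive part. -/
def bowl (ε t : ℝ) : ℝ := ∫ s in (0:ℝ)..t, ramp ε s

lemma contDiff_cut (ε : ℝ) {n : ℕ∞} : ContDiff ℝ n (cut ε) :=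
  Real.smoothTransition.contDiff.comp ((contDiff_id.div_const ε).sub contDiff_const)

lemma continuous_cut (ε : ℝ) : Continuous (cut ε) := (contDiff_cut ε (n := 0)).continuous

lemma cut_nonneg (ε t : ℝ) : 0 ≤ cut ε t := Real.smoothTransition.nonneg _

lemma cut_le_one (ε t : ℝ) : cut ε t ≤ 1 := Real.smoothTransition.le_one _

lemma cut_of_le (hε : 0 < ε) (h : t ≤ ε) : cut ε t = 0 :=
  Real.smoothTransition.zero_of_nonpos (by rw [sub_nonpos, div_le_one hε]; exact h)

lemma cut_of_ge (hε : 0 < ε) (h : 2 * ε ≤ t) : cut ε t = 1 :=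
  Real.smoothTransition.one_of_one_le (by
    have : 2 ≤ t / ε := by rwa [le_div_iff₀ hε]
    linarith)

lemma monotone_cut (hε : 0 < ε) : Monotone (cut ε) := fun a b h =>
  Real.smoothTransition.monotone (by gcongr)

lemma hasDerivAt_cut (ε t : ℝ) : HasDerivAt (cut ε) (deriv (cut ε) t) t :=
  ((contDiff_cut ε (n := 1)).differentiable (by simp) t).hasDerivAt

lemma deriv_cut_nonneg (hε : 0 < ε) (t : ℝ) : 0 ≤ deriv (cut ε) t := (monotone_cut hε).deriv_nonneg

lemma hasDerivAt_ramp (ε t : ℝ) : HasDerivAt (ramp ε) (cut ε t) t :=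
  intervalIntegral.integral_hasDerivAt_right ((continuous_cut ε).intervalIntegrable _ _)
    ((continuous_cut ε).stronglyMeasurableAtFilter _ _) (continuous_cut ε).continuousAt

lemma contDiff_ramp (ε : ℝ) : ContDiff ℝ 2 (ramp ε) := by
  rw [show (2 : WithTop ℕ∞) = 1 + 1 by norm_num, contDiff_succ_iff_deriv]
  refine ⟨fun t => (hasDerivAt_ramp ε t).differentiableAt, by simp, ?_⟩
  rw [show deriv (ramp ε) = cut ε from funext fun t => (hasDerivAt_ramp ε t).deriv]
  exact contDiff_cut ε (n := 1)

lemma continuous_ramp (ε : ℝ) : Continuous (ramp ε) := (contDiff_ramp ε).continuous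

lemma hasDerivAt_bowl (ε t : ℝ) : HasDerivAt (bowl ε) (ramp ε t) t :=
  intervalIntegral.integral_hasDerivAt_right ((continuous_ramp ε).intervalIntegrable _ _)
    ((continuous_ramp ε).stronglyMeasurableAtFilter _ _) (continuous_ramp ε).continuousAt

lemma contDiff_bowl (ε : ℝ) : ContDiff ℝ 2 (bowl ε) := by
  rw [show (2 : WithTop ℕ∞) = 1 + 1 by norm_num, contDiff_succ_iff_deriv]
  refine ⟨fun t => (hasDerivAt_bowl ε t).differentiableAt, by simp, ?_⟩
  rw [show deriv (bowl ε) = ramp ε from funext fun t => (hasDerivAt_bowl ε t).deriv]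
  exact (contDiff_ramp ε).of_le (by norm_num)

lemma ramp_of_le (hε : 0 < ε) (h : t ≤ ε) : ramp ε t = 0 := by
  rw [ramp, intervalIntegral.integral_congr (g := fun _ => (0:ℝ)), intervalIntegral.integral_zero]
  intro s hs
  have : s ≤ ε := (mem_uIcc.1 hs).elim (fun h' => h'.2.trans h) fun h' => h'.2.trans hε.le
  exact cut_of_le hε this

lemma bowl_of_le (hε : 0 < ε) (h : t ≤ ε) : bowl ε t = 0 := by
  rw [bowl, intervalIntegral.integral_congr (g := fun _ => (0:ℝ)), intervalIntegral.integral_zero]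
  intro s hs
  have : s ≤ ε := (mem_uIcc.1 hs).elim (fun h' => h'.2.trans h) fun h' => h'.2.trans hε.le
  exact ramp_of_le hε this

lemma ramp_nonneg (hε : 0 < ε) (t : ℝ) : 0 ≤ ramp ε t := by
  rcases le_total t ε with h | h
  · rw [ramp_of_le hε h]
  · exact intervalIntegral.integral_nonneg (hε.le.trans h) fun s _ => cut_nonneg ε s

lemma ramp_le_mul_cut (hε : 0 < ε) (ht : 0 ≤ t) : ramp ε t ≤ t * cut ε t := by
  have := intervalIntegral.integral_mono_on (μ := volume) ht ((continuous_cut ε).intervalIntegrable _ _)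
    (intervalIntegrable_const (c := cut ε t)) fun s hs => monotone_cut hε hs.2
  simpa [ramp] using this

lemma sub_le_ramp (hε : 0 < ε) (t : ℝ) : t - 2 * ε ≤ ramp ε t := by
  rcases le_total t (2 * ε) with h | h
  · linarith [ramp_nonneg hε t]
  · have h1 : ramp ε t = ramp ε (2 * ε) + ∫ s in (2 * ε)..t, cut ε s :=
      (intervalIntegral.integral_add_adjacent_intervals
        ((continuous_cut ε).intervalIntegrable _ _)
        ((continuous_cut ε).intervalIntegrable _ _)).symm
    have h2 : ∫ s in (2 * ε)..t, cut ε s = t - 2 * ε := by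
      rw [intervalIntegral.integral_congr (g := fun _ => (1:ℝ)), intervalIntegral.integral_const]
      · simp
      · intro s hs
        rw [uIcc_of_le h] at hs
        exact cut_of_ge hε hs.1
    linarith [ramp_nonneg hε (2 * ε)]

end Cutoffs

section Extension

variable {d : ℕ} {O : Set (Pt d)} {h : Pt d → ℝ}

lemma contDiff_indicator (hO : IsOpen O) (hC : ∀ z ∈ O, ContDiffAt ℝ 2 h z)
    (hv : ∀ z ∉ O, ∀ᶠ z' in nhds z, z' ∈ O → h z' = 0) : ContDiff ℝ 2 (O.indicator h) := by
  rw [contDiff_iff_contDiffAt]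
  intro z
  by_cases hz : z ∈ O
  · refine (hC z hz).congr_of_eventuallyEq ?_
    filter_upwards [hO.mem_nhds hz] with z' hz' using indicator_of_mem hz' h
  · refine (contDiffAt_const (c := (0:ℝ))).congr_of_eventuallyEq ?_
    filter_upwards [hv z hz] with z' hz'
    by_cases h' : z' ∈ O
    · rw [indicator_of_mem h', hz' h']
    · rw [indicator_of_notMem h']

lemma hasCompactSupport_indicator (hO : Bornology.IsBounded O) (h : Pt d → ℝ) :
    HasCompactSupport (O.indicator h) :=
  HasCompactSupport.intro hO.isCompact_closure fun _ hz =>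
    indicator_of_notMem (fun h' => hz (subset_closure h')) h

lemma indicator_eventuallyEq_of_isOpen (hO : IsOpen O) (h : Pt d → ℝ) {z : Pt d} (hz : z ∈ O) :
    O.indicator h =ᶠ[nhds z] h := by
  filter_upwards [hO.mem_nhds hz] with z' hz' using indicator_of_mem hz' h

end Extension

section Green

variable {d : ℕ} {f g u v : Pt d → ℝ}

instance instIsAddHaarMeasurePt : (volume : Measure (Pt d)).IsAddHaarMeasure :=
  inferInstanceAs (Measure.prod volume volume : Measure (Pt d)).IsAddHaarMeasure

lemma continuous_fderiv_apply_of_contDiff (hf : ContDiff ℝ 1 f) (w : Pt d) :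
    Continuous fun z => fderiv ℝ f z w :=
  (hf.continuous_fderiv (by simp)).clm_apply continuous_const

lemma contDiff_fderiv_apply_one (hf : ContDiff ℝ 2 f) (w : Pt d) :
    ContDiff ℝ 1 fun z => fderiv ℝ f z w :=
  (hf.fderiv_right (m := 1) (by norm_num)).clm_apply contDiff_const

lemma continuous_dd2 (hf : ContDiff ℝ 2 f) (w : Pt d) : Continuous (dd2 f w) :=
  continuous_fderiv_apply_of_contDiff (contDiff_fderiv_apply_one hf w) w

lemma continuous_lap (hf : ContDiff ℝ 2 f) : Continuous (lap f) := by
  rw [show lap f = fun z => ∑ o, dd2 f (dirs o) z from funext (lap_eq_sum f)]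
  exact continuous_finsetSum _ fun o _ => continuous_dd2 hf _

lemma continuous_gradSq (hf : ContDiff ℝ 1 f) : Continuous (gradSq f) := by
  rw [show gradSq f = _ from funext (gradSq_eq_sum f)]
  exact continuous_finsetSum _ fun o _ => (continuous_fderiv_apply_of_contDiff hf _).pow 2

lemma hasCompactSupport_fderiv_apply (hf : HasCompactSupport f) (w : Pt d) :
    HasCompactSupport fun z => fderiv ℝ f z w :=
  (hf.fderiv (𝕜 := ℝ)).comp_left (g := fun L : Pt d →L[ℝ] ℝ => L w) rfl

lemma hasCompactSupport_dd2 (hf : HasCompactSupport f) (w : Pt d) :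
    HasCompactSupport (dd2 f w) :=
  hasCompactSupport_fderiv_apply (hasCompactSupport_fderiv_apply hf w) w

lemma integral_mul_fderiv_eq (hf : ContDiff ℝ 1 f) (hg : ContDiff ℝ 1 g)
    (hc : HasCompactSupport g) (w : Pt d) :
    ∫ z, f z * fderiv ℝ g z w = -∫ z, fderiv ℝ f z w * g z := by
  have hfc := continuous_fderiv_apply_of_contDiff hf w
  have hgc := continuous_fderiv_apply_of_contDiff hg w
  refine integral_mul_fderiv_eq_neg_fderiv_mul_of_integrable ?_ ?_ ?_
    (fun z _ => hf.differentiable (by simp) z) fun z _ => hg.differentiable (by simp) z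
  · exact (hfc.mul hg.continuous).integrable_of_hasCompactSupport hc.mul_left
  · exact (hf.continuous.mul hgc).integrable_of_hasCompactSupport
      (hasCompactSupport_fderiv_apply hc w).mul_left
  · exact (hf.continuous.mul hg.continuous).integrable_of_hasCompactSupport hc.mul_left

lemma integral_mul_dd2_eq (hu : ContDiff ℝ 2 u) (hv : ContDiff ℝ 2 v)
    (hc : HasCompactSupport v) (w : Pt d) :
    ∫ z, u z * dd2 v w z = -∫ z, fderiv ℝ u z w * fderiv ℝ v z w :=
  integral_mul_fderiv_eq (hu.of_le (by norm_num)) (contDiff_fderiv_apply_one hv w)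
    (hasCompactSupport_fderiv_apply hc w) w

/-- Green's second identity for compactly supported functions. -/
theorem integral_mul_lap (hu : ContDiff ℝ 2 u) (hv : ContDiff ℝ 2 v)
    (huc : HasCompactSupport u) (hvc : HasCompactSupport v) :
    ∫ z, u z * lap v z = ∫ z, v z * lap u z := by
  have key : ∀ {a b : Pt d → ℝ}, ContDiff ℝ 2 a → ContDiff ℝ 2 b → HasCompactSupport b →
      ∫ z, a z * lap b z = -∑ o, ∫ z, fderiv ℝ a z (dirs o) * fderiv ℝ b z (dirs o) := by
    intro a b ha hb hbc
    simp only [lap_eq_sum, Finset.mul_sum]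
    rw [integral_finsetSum, ← Finset.sum_neg_distrib]
    · exact Finset.sum_congr rfl fun o _ => integral_mul_dd2_eq ha hb hbc _
    · exact fun o _ => (ha.continuous.mul (continuous_dd2 hb _)).integrable_of_hasCompactSupport
        (hasCompactSupport_dd2 hbc _).mul_left
  rw [key hu hv hvc, key hv hu huc]
  simp only [mul_comm]

end Green

section MeanValue

variable {d : ℕ}

/-- The squared Euclidean norm. -/
def normSq (z : Pt d) : ℝ := ∑ o, coord o z ^ 2

/-- A smooth radial kernel supported in the Euclidean unit ball. -/
def kern (z : Pt d) : ℝ := cut (1/8) (1 - normSq z)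

lemma normSq_nonneg (z : Pt d) : 0 ≤ normSq z := Finset.sum_nonneg fun _ _ => sq_nonneg _

lemma normSq_smul (r : ℝ) (z : Pt d) : normSq (r • z) = r ^ 2 * normSq z := by
  simp only [normSq, map_smul, smul_eq_mul, mul_pow, Finset.mul_sum]

lemma normSq_add_le (a b : Pt d) : normSq (a + b) ≤ 2 * normSq a + 2 * normSq b := by
  simp only [normSq, map_add, Finset.mul_sum, ← Finset.sum_add_distrib]
  exact Finset.sum_le_sum fun o _ => by nlinarith [sq_nonneg (coord o a - coord o b)]

lemma contDiff_normSq {n : WithTop ℕ∞} : ContDiff ℝ n (normSq (d := d)) :=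
  ContDiff.sum fun o _ => (coord o).contDiff.pow 2

lemma continuous_normSq : Continuous (normSq (d := d)) := (contDiff_normSq (n := 0)).continuous

lemma fderiv_normSq (z : Pt d) (o : Option (Fin (d+1))) :
    fderiv ℝ normSq z (dirs o) = 2 * coord o z := by
  have h : HasFDerivAt (normSq (d := d)) _ z :=
    HasFDerivAt.fun_sum (u := Finset.univ) fun o _ => ((coord o).hasFDerivAt (x := z)).pow 2
  rw [h.fderiv]
  cases o with
  | none => simp [Fintype.sum_option, coord, dirs]
  | some i => simp [Fintype.sum_option, coord, dirs, Pi.single_apply]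

lemma sq_coord_le_normSq (z : Pt d) (o : Option (Fin (d+1))) : coord o z ^ 2 ≤ normSq z :=
  Finset.single_le_sum (f := fun o => coord o z ^ 2) (fun _ _ => sq_nonneg _) (Finset.mem_univ o)

lemma norm_sq_le_normSq (z : Pt d) : ‖z‖ ^ 2 ≤ normSq z := by
  have h : ‖z‖ ≤ √(normSq z) := by
    refine norm_prod_le_iff.2 ⟨?_, (pi_norm_le_iff_of_nonneg (Real.sqrt_nonneg _)).2 fun i => ?_⟩
    · exact Real.abs_le_sqrt (sq_coord_le_normSq z none)
    · exact Real.abs_le_sqrt (sq_coord_le_normSq z (some i))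
  calc ‖z‖ ^ 2 ≤ √(normSq z) ^ 2 := by gcongr
    _ = normSq z := Real.sq_sqrt (normSq_nonneg z)

lemma kern_nonneg (z : Pt d) : 0 ≤ kern z := cut_nonneg _ _

lemma kern_le_one (z : Pt d) : kern z ≤ 1 := cut_le_one _ _

lemma kern_eq_one {z : Pt d} (h : normSq z ≤ 3 / 4) : kern z = 1 :=
  cut_of_ge (by norm_num) (by linarith)

lemma kern_eq_zero {z : Pt d} (h : 1 ≤ normSq z) : kern z = 0 :=
  cut_of_le (by norm_num) (by linarith)

lemma continuous_kern : Continuous (kern (d := d)) :=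
  (continuous_cut _).comp (continuous_const.sub continuous_normSq)

lemma hasCompactSupport_of_normSq {f : Pt d → ℝ} (h : ∀ z, 1 ≤ normSq z → f z = 0) :
    HasCompactSupport f := by
  refine HasCompactSupport.intro (isCompact_closedBall (0 : Pt d) 1) fun z hz => h z ?_
  rw [mem_closedBall_zero_iff, not_le] at hz
  nlinarith [norm_sq_le_normSq z]

lemma hasCompactSupport_kern : HasCompactSupport (kern (d := d)) :=
  hasCompactSupport_of_normSq fun _ => kern_eq_zero

lemma integrable_kern : Integrable (kern (d := d)) :=
  continuous_kern.integrable_of_hasCompactSupport hasCompactSupport_kern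

lemma integral_kern_pos : 0 < ∫ z : Pt d, kern z :=
  continuous_kern.integral_pos_of_hasCompactSupport_nonneg_nonzero hasCompactSupport_kern
    kern_nonneg (x := 0) (by rw [kern_eq_one (by simp only [normSq, map_zero]; norm_num)]; exact one_ne_zero)

/-- A compactly supported radial function whose gradient is `-2 z kern z`. -/
def kernPrim (z : Pt d) : ℝ := ramp (1/8) (1 - normSq z)

lemma contDiff_kernPrim : ContDiff ℝ 2 (kernPrim (d := d)) :=
  (contDiff_ramp _).comp (contDiff_const.sub contDiff_normSq)

lemma hasCompactSupport_kernPrim : HasCompactSupport (kernPrim (d := d)) :=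
  hasCompactSupport_of_normSq fun _ h => ramp_of_le (by norm_num) (by linarith)

lemma fderiv_kernPrim (z : Pt d) (o : Option (Fin (d+1))) :
    fderiv ℝ kernPrim z (dirs o) = -2 * (coord o z * kern z) := by
  have hd : DifferentiableAt ℝ (fun z : Pt d => 1 - normSq z) z :=
    (contDiff_const.sub contDiff_normSq).differentiable (n := 1) (by simp) z
  have h := fderiv_comp_apply hd (hasDerivAt_ramp (1/8) (1 - normSq z)) (dirs o)
  have h2 : fderiv ℝ (fun z : Pt d => 1 - normSq z) z (dirs o) = -(2 * coord o z) := by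
    rw [fderiv_const_sub, neg_apply, fderiv_normSq]
  rw [h2] at h
  rw [show kernPrim = fun z : Pt d => ramp (1/8) (1 - normSq z) from rfl, h, kern]; ring

variable {W : Pt d → ℝ}

lemma integral_fderiv_radial (hW : ContDiff ℝ 2 W) (z : Pt d) (r : ℝ) :
    ∫ y, fderiv ℝ W (z + r • y) y * kern y =
      r / 2 * ∫ y, lap W (z + r • y) * kernPrim y := by
  have haff : ContDiff ℝ 2 fun y : Pt d => z + r • y := by fun_prop
  have hfd : ∀ (f : Pt d → ℝ), Differentiable ℝ f → ∀ y w : Pt d,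
      fderiv ℝ (fun y => f (z + r • y)) y w = r * fderiv ℝ f (z + r • y) w := by
    intro f hf y w
    have h1 : HasFDerivAt (fun y : Pt d => z + r • y) _ y :=
      ((hasFDerivAt_id (𝕜 := ℝ) y).const_smul r).const_add z
    have := (hf (z + r • y)).hasFDerivAt.comp y h1
    rw [show (fun y => f (z + r • y)) = f ∘ fun y => z + r • y from rfl, this.fderiv]
    simp
  have hD : ∀ o, ContDiff ℝ 1 fun y => fderiv ℝ W (z + r • y) (dirs o) := fun o =>
    (contDiff_fderiv_apply_one hW (dirs o)).comp (haff.of_le (by norm_num))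
  have hint : ∀ o, ∫ y, fderiv ℝ W (z + r • y) (dirs o) * fderiv ℝ kernPrim y (dirs o) =
      -(r * ∫ y, dd2 W (dirs o) (z + r • y) * kernPrim y) := by
    intro o
    rw [integral_mul_fderiv_eq (hD o) (contDiff_kernPrim.of_le (by norm_num))
      hasCompactSupport_kernPrim, ← integral_const_mul]
    congr 2
    ext y
    rw [hfd _ ((contDiff_fderiv_apply_one hW (dirs o)).differentiable (by simp))]
    simp only [dd2]; ring
  have hpt : ∀ y, fderiv ℝ W (z + r • y) y * kern y =
      ∑ o, -(1/2) * (fderiv ℝ W (z + r • y) (dirs o) * fderiv ℝ kernPrim y (dirs o)) := by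
    intro y
    rw [clm_apply_eq_sum, Finset.sum_mul]
    exact Finset.sum_congr rfl fun o _ => by rw [fderiv_kernPrim]; ring
  simp only [hpt, lap_eq_sum, Finset.sum_mul]
  rw [integral_finsetSum, integral_finsetSum, Finset.mul_sum]
  · refine Finset.sum_congr rfl fun o _ => ?_
    rw [integral_const_mul, hint]; ring
  · exact fun o _ => (((continuous_dd2 hW _).comp haff.continuous).mul
      contDiff_kernPrim.continuous).integrable_of_hasCompactSupport
        hasCompactSupport_kernPrim.mul_left
  · exact fun o _ => (((hD o).continuous.mul (continuous_fderiv_apply_of_contDiff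
      (contDiff_kernPrim.of_le (by norm_num)) _)).integrable_of_hasCompactSupport
        (hasCompactSupport_fderiv_apply hasCompactSupport_kernPrim _).mul_left).const_mul _

lemma hasDerivAt_radial (hW : ContDiff ℝ 2 W) (z : Pt d) (r : ℝ) :
    HasDerivAt (fun r : ℝ => ∫ y, W (z + r • y) * kern y)
      (∫ y, fderiv ℝ W (z + r • y) y * kern y) r := by
  have hc : Continuous fun p : ℝ × Pt d => fderiv ℝ W (z + p.1 • p.2) p.2 :=
    ((hW.continuous_fderiv (by simp)).comp (by fun_prop)).clm_apply continuous_snd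
  obtain ⟨C, hC⟩ := ((isCompact_closedBall r 1).prod
    (isCompact_closedBall (0 : Pt d) 1)).exists_bound_of_continuousOn hc.continuousOn
  have hcr : ∀ s : ℝ, Continuous fun y => W (z + s • y) * kern y := fun s =>
    (hW.continuous.comp (by fun_prop)).mul continuous_kern
  refine (hasDerivAt_integral_of_dominated_loc_of_deriv_le (μ := volume)
    (F := fun (s : ℝ) y => W (z + s • y) * kern y)
    (F' := fun s y => fderiv ℝ W (z + s • y) y * kern y) (bound := fun y => C * kern y)
    (Metric.closedBall_mem_nhds r one_pos) (Eventually.of_forall fun s => ?_) ?_ ?_ ?_ ?_ ?_).2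
  · exact (hcr s).aestronglyMeasurable
  · exact (hcr r).integrable_of_hasCompactSupport hasCompactSupport_kern.mul_left
  · exact ((hc.comp (Continuous.prodMk_right r)).mul continuous_kern).aestronglyMeasurable
  · refine Eventually.of_forall fun y s hs => ?_
    rw [norm_mul, Real.norm_of_nonneg (kern_nonneg y)]
    by_cases hy : 1 ≤ normSq y
    · simp [kern_eq_zero hy]
    · refine mul_le_mul_of_nonneg_right (hC (s, y) ⟨hs, ?_⟩) (kern_nonneg y)
      rw [mem_closedBall_zero_iff]
      nlinarith [norm_sq_le_normSq y, norm_nonneg y]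
  · exact integrable_kern.const_mul C
  · refine Eventually.of_forall fun y s _ => ?_
    have h1 : HasDerivAt (fun s : ℝ => z + s • y) y s := by
      simpa using ((hasDerivAt_id s).smul_const y).const_add z
    exact ((hW.differentiable (by simp) (z + s • y)).hasFDerivAt.comp_hasDerivAt s h1).mul_const _

/-- The mean value inequality for subharmonic functions, with a smooth radial kernel. -/
theorem mul_integral_kern_le (hW : ContDiff ℝ 2 W) {z : Pt d} {R : ℝ} (hR : 0 < R)
    (hl : ∀ z', normSq (z' - z) < R ^ 2 → 0 ≤ lap W z') :
    W z * ∫ y : Pt d, kern y ≤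
      (R ^ Module.finrank ℝ (Pt d))⁻¹ * ∫ y, W y * kern (R⁻¹ • (y - z)) := by
  have hmono : MonotoneOn (fun r : ℝ => ∫ y, W (z + r • y) * kern y) (Icc 0 R) := by
    refine monotoneOn_of_deriv_nonneg (convex_Icc 0 R)
      (fun r _ => (hasDerivAt_radial hW z r).continuousAt.continuousWithinAt)
      (fun r _ => (hasDerivAt_radial hW z r).differentiableAt.differentiableWithinAt) ?_
    intro r hr
    rw [interior_Icc] at hr
    rw [(hasDerivAt_radial hW z r).deriv, integral_fderiv_radial hW]
    refine mul_nonneg (by linarith [hr.1]) (integral_nonneg fun y => ?_)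
    by_cases hy : 1 ≤ normSq y
    · rw [kernPrim, ramp_of_le (by norm_num) (by linarith), mul_zero, Pi.zero_apply]
    · refine mul_nonneg (hl _ ?_) (ramp_nonneg (by norm_num) _)
      rw [add_sub_cancel_left, normSq_smul]
      have h1 : r ^ 2 * normSq y ≤ r ^ 2 * 1 := by
        gcongr; linarith
      have h2 : r ^ 2 < R ^ 2 := by
        have := hr.1; have := hr.2; gcongr
      linarith
  have h := hmono (left_mem_Icc.2 hR.le) (right_mem_Icc.2 hR.le) hR.le
  simp only [zero_smul, add_zero] at h
  rw [integral_const_mul] at h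
  refine h.trans_eq ?_
  have h1 := Measure.integral_comp_smul (volume : Measure (Pt d))
    (fun y => W (z + y) * kern (R⁻¹ • y)) R
  simp only [smul_smul, inv_mul_cancel₀ hR.ne', one_smul] at h1
  rw [h1, abs_of_nonneg (by positivity), smul_eq_mul]
  congr 1
  rw [← integral_sub_right_eq_self (fun y => W (z + y) * kern (R⁻¹ • y)) z]
  simp

end MeanValue

section SlabGeometry

variable {d : ℕ} {U : Set (Fin (d+1) → ℝ)} {F : (Fin (d+1) → ℝ) → ℝ} {u : Pt d → ℝ} {ε : ℝ}

/-- `U` is a bounded connected domain with the regular defining function `F`, positive inside. -/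
structure IsSmoothDomain (U : Set (Fin (d+1) → ℝ)) (F : (Fin (d+1) → ℝ) → ℝ) : Prop where
  isBounded : Bornology.IsBounded U
  isConnected : IsConnected U
  contDiff : ContDiff ℝ 2 F
  eq_pos : U = {y | 0 < F y}
  fderiv_ne : ∀ y ∈ frontier U, fderiv ℝ F y ≠ 0

/-- The slab of half-width one over `U`. -/
def slab (U : Set (Fin (d+1) → ℝ)) : Set (Pt d) := Ioo (-1) 1 ×ˢ U

/-- A function positive in the slab and vanishing on its boundary. -/
def slabHt (F : (Fin (d+1) → ℝ) → ℝ) (z : Pt d) : ℝ := (1 - z.1 ^ 2) * F z.2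

/-- The pullback of a function of the cross-section coordinate. -/
def lift (F : (Fin (d+1) → ℝ) → ℝ) (z : Pt d) : ℝ := F z.2

/-- Nonnegative harmonic functions in the slab vanishing on its lateral boundary. -/
structure IsSlabSolution (U : Set (Fin (d+1) → ℝ)) (u : Pt d → ℝ) : Prop where
  nonneg : ∀ z ∈ slab U, 0 ≤ u z
  contDiffAt : ∀ z ∈ slab U, ContDiffAt ℝ 2 u z
  lap_eq : ∀ z ∈ slab U, lap u z = 0
  continuousOn : ContinuousOn u (Icc (-1) 1 ×ˢ closure U)
  eq_zero : ∀ z : Pt d, z.1 ∈ Icc (-1 : ℝ) 1 → z.2 ∈ frontier U → u z = 0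

namespace IsSmoothDomain

variable (hU : IsSmoothDomain U F)
include hU

lemma isOpen : IsOpen U := by
  rw [hU.eq_pos]; exact isOpen_lt continuous_const hU.contDiff.continuous

lemma pos {y} (hy : y ∈ U) : 0 < F y := by rwa [hU.eq_pos] at hy

lemma nonpos {y} (hy : y ∉ U) : F y ≤ 0 := by rwa [hU.eq_pos, mem_ofPred_eq, not_lt] at hy

lemma nonneg_of_mem_closure {y} (hy : y ∈ closure U) : 0 ≤ F y :=
  closure_minimal (fun _ h => (hU.pos h).le)
    (isClosed_le continuous_const hU.contDiff.continuous) hy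

lemma eq_zero {y} (hy : y ∈ frontier U) : F y = 0 := by
  rw [hU.isOpen.frontier_eq] at hy
  exact le_antisymm (hU.nonpos hy.2) (hU.nonneg_of_mem_closure hy.1)

lemma mem_of_pos {y} (h : 0 < F y) : y ∈ U := by
  rwa [hU.eq_pos]

lemma isCompact_closure : IsCompact (closure U) := hU.isBounded.isCompact_closure

lemma isOpen_slab : IsOpen (slab U) := isOpen_Ioo.prod hU.isOpen

lemma isBounded_slab : Bornology.IsBounded (slab U) := (Metric.isBounded_Ioo _ _).prod hU.isBounded

lemma isPreconnected_slab : IsPreconnected (slab U) :=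
  isPreconnected_Ioo.prod hU.isConnected.isPreconnected

omit hU in
lemma closure_slab : closure (slab U) = Icc (-1) 1 ×ˢ closure U := by
  rw [slab, closure_prod_eq, closure_Ioo (by norm_num)]

lemma contDiff_lift : ContDiff ℝ 2 (lift F) := hU.contDiff.comp contDiff_snd

lemma contDiff_slabHt : ContDiff ℝ 2 (slabHt F) :=
  (contDiff_const.sub (contDiff_fst.pow 2)).mul hU.contDiff_lift

lemma slabHt_pos {z : Pt d} (hz : z ∈ slab U) : 0 < slabHt F z := by
  have h1 := hz.1.1
  have h2 := hz.1.2
  exact mul_pos (by nlinarith) (hU.pos hz.2)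

lemma slabHt_eq_zero {z : Pt d} (hz : z ∉ slab U) (hc : z ∈ closure (slab U)) :
    slabHt F z = 0 := by
  rw [closure_slab] at hc
  rw [slabHt]
  by_cases h : z.2 ∈ U
  · have h1 : ¬ z.1 ∈ Ioo (-1 : ℝ) 1 := fun h' => hz ⟨h', h⟩
    have : z.1 = 1 ∨ z.1 = -1 := by
      by_contra! hne
      exact h1 ⟨lt_of_le_of_ne hc.1.1 (Ne.symm hne.2), lt_of_le_of_ne hc.1.2 hne.1⟩
    rcases this with h | h <;> simp [h]
  · rw [hU.eq_zero (by rw [hU.isOpen.frontier_eq]; exact ⟨hc.2, h⟩), mul_zero]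

lemma eventually_slabHt_lt (hε : 0 < ε) {z : Pt d} (hz : z ∉ slab U) :
    ∀ᶠ z' in nhds z, z' ∈ slab U → slabHt F z' < ε := by
  by_cases hc : z ∈ closure (slab U)
  · have h : slabHt F z < ε := by rwa [hU.slabHt_eq_zero hz hc]
    filter_upwards [hU.contDiff_slabHt.continuous.continuousAt.eventually_lt_const h] with z' h' _
    exact h'
  · filter_upwards [isClosed_closure.isOpen_compl.mem_nhds hc] with z' h1 h2
    exact absurd (subset_closure h2) h1

omit hU in
lemma fderiv_lift_none (hF : ContDiff ℝ 2 F) (z : Pt d) : fderiv ℝ (lift F) z (dirs none) = 0 := by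
  have h : HasFDerivAt (lift F) _ z :=
    ((hF.differentiable (by norm_num) z.2).hasFDerivAt).comp z (hasFDerivAt_snd (𝕜 := ℝ))
  rw [h.fderiv]
  simp [dirs]

omit hU in
lemma fderiv_lift_some (hF : ContDiff ℝ 2 F) (z : Pt d) (i) :
    fderiv ℝ (lift F) z (dirs (some i)) = fderiv ℝ F z.2 (Pi.single i 1) := by
  have h : HasFDerivAt (lift F) _ z :=
    ((hF.differentiable (by norm_num) z.2).hasFDerivAt).comp z (hasFDerivAt_snd (𝕜 := ℝ))
  rw [h.fderiv]
  simp [dirs]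

/-- Uniform gradient and Laplacian bounds for the defining function. -/
lemma exists_bounds : ∃ q C : ℝ, 0 < q ∧ 0 ≤ C ∧ ∀ z : Pt d, z.2 ∈ closure U →
    (F z.2 ≤ q → q ≤ gradSq (lift F) z) ∧ |lap (lift F) z| ≤ C ∧ F z.2 ≤ C := by
  have hlift : ∀ z : Pt d, (fun z' => lift F (z' + (z.1, 0))) = lift F := by
    intro z; ext z'; simp [lift]
  have hg : ∀ z : Pt d, gradSq (lift F) z = gradSq (lift F) (0, z.2) := by
    intro z
    have := gradSq_comp_add (lift F) (z.1, 0) (0, z.2)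
    rw [hlift] at this
    simpa using this.symm
  have hl : ∀ z : Pt d, lap (lift F) z = lap (lift F) (0, z.2) := by
    intro z
    have := lap_comp_add (lift F) (z.1, 0) (0, z.2)
    rw [hlift] at this
    simpa using this.symm
  have hi : Continuous fun y : Fin (d+1) → ℝ => ((0, y) : Pt d) := by fun_prop
  have hgc : Continuous fun y => gradSq (lift F) (0, y) :=
    (continuous_gradSq (hU.contDiff_lift.of_le (by norm_num))).comp hi
  have hlc : Continuous fun y => lap (lift F) (0, y) := (continuous_lap hU.contDiff_lift).comp hi
  obtain ⟨C1, hC1⟩ := hU.isCompact_closure.exists_bound_of_continuousOn hlc.continuousOn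
  obtain ⟨C2, hC2⟩ := hU.isCompact_closure.exists_bound_of_continuousOn
    hU.contDiff.continuous.continuousOn
  obtain ⟨y0, hy0, hmin⟩ := hU.isCompact_closure.exists_isMinOn hU.isConnected.nonempty.closure
    (hU.contDiff.continuous.add hgc).continuousOn
  have hpos : 0 < F y0 + gradSq (lift F) (0, y0) := by
    rcases (hU.nonneg_of_mem_closure hy0).lt_or_eq with h | h
    · linarith [gradSq_nonneg (lift F) (0, y0)]
    · rw [← h, zero_add]
      have hfr : y0 ∈ frontier U := by
        rw [hU.isOpen.frontier_eq]
        exact ⟨hy0, fun h' => (hU.pos h').ne h⟩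
      by_contra! hle
      apply hU.fderiv_ne y0 hfr
      have h0 : ∀ o, fderiv ℝ (lift F) (0, y0) (dirs o) = 0 := by
        intro o
        rw [gradSq_eq_sum] at hle
        have := (Finset.sum_eq_zero_iff_of_nonneg fun o _ => sq_nonneg _).1
          (le_antisymm hle (Finset.sum_nonneg fun o _ => sq_nonneg _)) o (Finset.mem_univ o)
        exact pow_eq_zero_iff two_ne_zero |>.1 this
      refine ContinuousLinearMap.ext fun v => ?_
      have hv : v = ∑ i, v i • (Pi.single i 1 : Fin (d+1) → ℝ) := by
        ext j; simp [Finset.sum_apply, Pi.single_apply]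
      rw [hv, map_sum]
      refine Finset.sum_eq_zero fun i _ => ?_
      rw [map_smul, ← fderiv_lift_some hU.contDiff (0, y0), h0, smul_zero]
  refine ⟨(F y0 + gradSq (lift F) (0, y0)) / 2, max 0 (max C1 C2), by linarith, le_max_left _ _,
    fun z hz => ⟨fun hq => ?_, ?_, ?_⟩⟩
  · rw [hg z]
    have : F y0 + gradSq (lift F) (0, y0) ≤ F z.2 + gradSq (lift F) (0, z.2) := hmin hz
    linarith
  · rw [hl z]
    exact (hC1 _ hz).trans ((le_max_left _ _).trans (le_max_right _ _))
  · exact (le_abs_self _).trans ((hC2 _ hz).trans ((le_max_right _ _).trans (le_max_right _ _)))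

omit hU in
lemma gradSq_lift_add (hF : ContDiff ℝ 2 F) (k : ℝ) (z : Pt d) :
    gradSq (lift F) z ≤ gradSq (fun z : Pt d => lift F z + k * z.1 ^ 2) z := by
  have h1 : DifferentiableAt ℝ (lift F) z := (hF.comp contDiff_snd).differentiable (by norm_num) z
  have h2 : HasFDerivAt (fun z : Pt d => k * z.1 ^ 2) _ z :=
    ((hasFDerivAt_fst (𝕜 := ℝ)).pow 2).const_mul k
  rw [gradSq_eq_sum, gradSq_eq_sum, Fintype.sum_option, Fintype.sum_option, fderiv_lift_none hF]
  refine add_le_add ?_ (Finset.sum_le_sum fun i _ => le_of_eq ?_)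
  · simp only [ne_eq, OfNat.ofNat_ne_zero, not_false_eq_true, zero_pow]; positivity
  · rw [fderiv_fun_add h1 h2.differentiableAt, h2.fderiv]
    simp [dirs]

omit hU in
lemma lap_lift_add (hF : ContDiff ℝ 2 F) (k : ℝ) (z : Pt d) :
    lap (fun z : Pt d => lift F z + k * z.1 ^ 2) z = lap (lift F) z + 2 * k := by
  have h1 : ContDiffAt ℝ 2 (lift F) z := (hF.comp contDiff_snd).contDiffAt
  have h2 : ContDiffAt ℝ 2 (fun z : Pt d => z.1 ^ 2) z := (contDiff_fst.pow 2).contDiffAt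
  rw [lap_add h1 (contDiffAt_const.mul h2), lap_const_mul h2, lap_fst_sq]; ring

omit hU in
lemma fderiv_one_sub_sq (z w : Pt d) :
    fderiv ℝ (fun z : Pt d => 1 - z.1 ^ 2) z w = -(2 * z.1 * w.1) := by
  have h2 : HasFDerivAt (fun z : Pt d => 1 - z.1 ^ 2) _ z :=
    ((hasFDerivAt_fst (𝕜 := ℝ)).pow 2).const_sub 1
  rw [h2.fderiv]; simp

lemma gradSq_slabHt (z : Pt d) : gradSq (slabHt F) z =
    4 * z.1 ^ 2 * F z.2 ^ 2 + (1 - z.1 ^ 2) ^ 2 * gradSq (lift F) z := by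
  have h1 : DifferentiableAt ℝ (lift F) z := hU.contDiff_lift.differentiable (by norm_num) z
  have h2 : ContDiff ℝ 2 (fun z : Pt d => 1 - z.1 ^ 2) := contDiff_const.sub (contDiff_fst.pow 2)
  have h : ∀ w, fderiv ℝ (slabHt F) z w = (1 - z.1 ^ 2) * fderiv ℝ (lift F) z w +
      lift F z * fderiv ℝ (fun z : Pt d => 1 - z.1 ^ 2) z w :=
    fderiv_mul_apply (h2.differentiable (by norm_num) z) h1
  rw [gradSq_eq_sum, gradSq_eq_sum]
  simp only [h, fderiv_one_sub_sq]
  rw [Fintype.sum_option, Fintype.sum_option, fderiv_lift_none hU.contDiff, mul_add, Finset.mul_sum]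
  simp only [dirs, Option.elim, show lift F z = F z.2 from rfl]
  ring_nf

lemma lap_slabHt (z : Pt d) : lap (slabHt F) z =
    (1 - z.1 ^ 2) * lap (lift F) z - 2 * F z.2 := by
  have h1 : ContDiffAt ℝ 2 (lift F) z := hU.contDiff_lift.contDiffAt
  have h3 : ContDiffAt ℝ 2 (fun z : Pt d => z.1 ^ 2) z := (contDiff_fst.pow 2).contDiffAt
  have h2 : ContDiffAt ℝ 2 (fun z : Pt d => 1 - z.1 ^ 2) z := contDiffAt_const.sub h3
  have h : ∀ w, dd2 (slabHt F) w z = (1 - z.1 ^ 2) * dd2 (lift F) w z +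
      2 * (fderiv ℝ (fun z : Pt d => 1 - z.1 ^ 2) z w * fderiv ℝ (lift F) z w) +
      lift F z * dd2 (fun z : Pt d => 1 - z.1 ^ 2) w z := fun w => dd2_mul h2 h1
  have hl : lap (fun z : Pt d => 1 - z.1 ^ 2) z = -2 := by
    rw [lap_sub contDiffAt_const h3, lap_const, lap_fst_sq]; ring
  rw [lap_eq_sum] at hl
  rw [lap_eq_sum, lap_eq_sum]
  simp only [h, Finset.sum_add_distrib, ← Finset.mul_sum, hl]
  have h0 : ∑ o, fderiv ℝ (fun z : Pt d => 1 - z.1 ^ 2) z (dirs o) * fderiv ℝ (lift F) z (dirs o)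
      = 0 := by
    refine Finset.sum_eq_zero fun o _ => ?_
    cases o with
    | none => rw [fderiv_lift_none hU.contDiff, mul_zero]
    | some i => rw [fderiv_one_sub_sq]; simp [dirs]
  rw [h0, show lift F z = F z.2 from rfl]
  ring

end IsSmoothDomain

end SlabGeometry

section Harnack

variable {d : ℕ} {U : Set (Fin (d+1) → ℝ)} {F : (Fin (d+1) → ℝ) → ℝ} {u : Pt d → ℝ} {ε : ℝ}

/-- A slab solution cut off near the boundary of the slab. -/
def cutOff (U : Set (Fin (d+1) → ℝ)) (F : (Fin (d+1) → ℝ) → ℝ) (ε : ℝ) (u : Pt d → ℝ) : Pt d → ℝ :=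
  (slab U).indicator fun z => u z * cut ε (slabHt F z)

namespace IsSlabSolution

variable (hU : IsSmoothDomain U F) (hu : IsSlabSolution U u)
include hU hu

lemma contDiff_cutOff (hε : 0 < ε) : ContDiff ℝ 2 (cutOff U F ε u) := by
  refine contDiff_indicator hU.isOpen_slab (fun z hz => (hu.contDiffAt z hz).mul
    (((contDiff_cut ε (n := 2)).comp hU.contDiff_slabHt).contDiffAt)) fun z hz => ?_
  filter_upwards [hU.eventually_slabHt_lt hε hz] with z' h' hz'
  rw [cut_of_le hε (h' hz').le, mul_zero]

omit hu in
lemma cutOff_eventuallyEq (hε : 0 < ε) {z : Pt d} (hz : z ∈ slab U) (h : 2 * ε < slabHt F z) :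
    cutOff U F ε u =ᶠ[nhds z] u := by
  filter_upwards [hU.isOpen_slab.mem_nhds hz,
    hU.contDiff_slabHt.continuous.continuousAt.eventually_const_lt h] with z' h1 h2
  rw [cutOff, indicator_of_mem h1, cut_of_ge hε h2.le, mul_one]

lemma lap_cutOff (hε : 0 < ε) {z : Pt d} (hz : z ∈ slab U) (h : 2 * ε < slabHt F z) :
    lap (cutOff U F ε u) z = 0 := by
  rw [lap_congr (cutOff_eventuallyEq hU hε hz h), hu.lap_eq z hz]

omit hU in
lemma cutOff_nonneg (z : Pt d) : 0 ≤ cutOff U F ε u z :=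
  indicator_nonneg (fun z hz => mul_nonneg (hu.nonneg z hz) (cut_nonneg _ _)) z

omit hU in
lemma cutOff_le {z : Pt d} (hz : z ∈ slab U) : cutOff U F ε u z ≤ u z := by
  rw [cutOff, indicator_of_mem hz]
  exact mul_le_of_le_one_right (hu.nonneg z hz) (cut_le_one _ _)

omit hu in
lemma hasCompactSupport_cutOff : HasCompactSupport (cutOff U F ε u) :=
  hasCompactSupport_indicator hU.isBounded_slab _

end IsSlabSolution

namespace IsSmoothDomain

variable (hU : IsSmoothDomain U F)
include hU

lemma exists_local_harnack {z0 : Pt d} (hz0 : z0 ∈ slab U) : ∃ V ∈ nhds z0, V ⊆ slab U ∧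
    ∀ u, IsSlabSolution U u → ∀ z ∈ V, ∀ z' ∈ V, u z ≤ 2 ^ Module.finrank ℝ (Pt d) * u z' := by
  set ε := slabHt F z0 / 4 with hε_def
  have hg0 := hU.slabHt_pos hz0
  have hε : 0 < ε := by positivity
  have hnh : slab U ∩ {z | 2 * ε < slabHt F z} ∈ nhds z0 :=
    inter_mem (hU.isOpen_slab.mem_nhds hz0)
      (hU.contDiff_slabHt.continuous.continuousAt.eventually_const_lt (by linarith))
  obtain ⟨r, hr, hball⟩ := Metric.mem_nhds_iff.1 hnh
  set R := r / 4 with hR_def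
  have hR : 0 < R := by positivity
  have hin : ∀ y, normSq (y - z0) ≤ 9 * R ^ 2 → y ∈ slab U ∧ 2 * ε < slabHt F y := by
    intro y hy
    refine hball ?_
    rw [mem_ball_iff_norm]
    have h1 := (norm_sq_le_normSq (y - z0)).trans hy
    have h2 : ‖y - z0‖ ≤ 3 * R := abs_le_of_sq_le_sq' (by nlinarith) (by positivity) |>.2
    linarith
  have hV : {z | normSq (z - z0) < R ^ 2 / 8} ∈ nhds z0 := by
    have hc : Continuous fun z : Pt d => normSq (z - z0) :=
      continuous_normSq.comp (continuous_sub_right z0)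
    refine hc.continuousAt.eventually_lt_const ?_
    simp only [sub_self, normSq, map_zero]
    norm_num; positivity
  have hVin : ∀ z, normSq (z - z0) < R ^ 2 / 8 → z ∈ slab U ∧ 2 * ε < slabHt F z := fun z hz =>
    hin z (by nlinarith)
  refine ⟨_, hV, fun z hz => (hVin z hz).1, fun u hu z hz z' hz' => ?_⟩
  set v := cutOff U F ε u with hv_def
  set I := ∫ y : Pt d, kern y
  have hI : 0 < I := integral_kern_pos
  have hv2 : ContDiff ℝ 2 v := hu.contDiff_cutOff hU hε
  have hvc : HasCompactSupport v := IsSlabSolution.hasCompactSupport_cutOff hU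
  have hveq : ∀ y, y ∈ slab U ∧ 2 * ε < slabHt F y → v y = u y := fun y hy =>
    (IsSlabSolution.cutOff_eventuallyEq hU hε hy.1 hy.2).eq_of_nhds
  have hlap : ∀ y, normSq (y - z0) ≤ 9 * R ^ 2 → lap v y = 0 := fun y hy =>
    hu.lap_cutOff hU hε (hin y hy).1 (hin y hy).2
  have hsplit : ∀ a b : Pt d, normSq (a - z0) ≤ 2 * normSq (a - b) + 2 * normSq (b - z0) := by
    intro a b
    have := normSq_add_le (a - b) (b - z0)
    rwa [sub_add_sub_cancel] at this
  have hsymm : ∀ a b : Pt d, normSq (a - b) = normSq (b - a) := by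
    intro a b
    rw [← neg_sub, ← neg_one_smul ℝ, normSq_smul]; norm_num
  have hz : normSq (z - z0) < R ^ 2 / 8 := hz
  have hz' : normSq (z' - z0) < R ^ 2 / 8 := hz'
  have hdist : normSq (z - z') ≤ R ^ 2 / 2 := by
    have := normSq_add_le (z - z0) (z0 - z')
    rw [sub_add_sub_cancel, hsymm z0 z'] at this
    linarith
  have h1 := mul_integral_kern_le hv2 (z := z) hR fun y hy => by
    rw [hlap y (by have := hsplit y z; nlinarith)]
  have h2 := mul_integral_kern_le hv2.neg (z := z') (R := 2 * R) (by positivity) fun y hy => by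
    have h3 : lap (fun x => -v x) y = 0 := by
      have := lap_const_mul (c := -1) (hv2.contDiffAt (x := y))
      rw [hlap y (by have := hsplit y z'; nlinarith)] at this
      simpa using this
    rw [h3]
  have hkern : ∀ y, kern (R⁻¹ • (y - z)) ≤ kern ((2 * R)⁻¹ • (y - z')) := by
    intro y
    by_cases h : 1 ≤ normSq (R⁻¹ • (y - z))
    · rw [kern_eq_zero h]; exact kern_nonneg _
    · rw [kern_eq_one (z := (2 * R)⁻¹ • (y - z'))]
      · exact kern_le_one _
      · rw [normSq_smul, inv_pow, not_le, inv_mul_lt_iff₀ (by positivity)] at h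
        rw [normSq_smul, inv_pow, inv_mul_le_iff₀ (by positivity)]
        have := normSq_add_le (y - z) (z - z')
        rw [sub_add_sub_cancel] at this
        nlinarith
  have hint : ∀ (ρ : ℝ) (x : Pt d), Integrable fun y => v y * kern (ρ • (y - x)) := fun ρ x =>
    (hv2.continuous.mul (continuous_kern.comp (by fun_prop))).integrable_of_hasCompactSupport
      hvc.mul_right
  have hle : ∫ y, v y * kern (R⁻¹ • (y - z)) ≤ ∫ y, v y * kern ((2 * R)⁻¹ • (y - z')) :=
    integral_mono (hint _ _) (hint _ _) fun y =>
      mul_le_mul_of_nonneg_left (hkern y) (hu.cutOff_nonneg y)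
  simp only [neg_mul, integral_neg, mul_neg, neg_le_neg_iff] at h2
  set N := Module.finrank ℝ (Pt d)
  rw [hveq z (hVin z hz)] at h1
  rw [hveq z' (hVin z' hz')] at h2
  rw [← div_eq_inv_mul, div_le_iff₀ (by positivity)] at h2
  rw [← div_eq_inv_mul, le_div_iff₀ (by positivity)] at h1
  have h3 : u z * (I * R ^ N) ≤ (2 ^ N * u z') * (I * R ^ N) := by
    calc u z * (I * R ^ N) = u z * I * R ^ N := by ring
      _ ≤ u z' * I * (2 * R) ^ N := h1.trans (hle.trans h2)
      _ = _ := by rw [mul_pow]; ring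
  exact le_of_mul_le_mul_right h3 (by positivity)

/-- Harnack's inequality in the slab. -/
theorem exists_harnack {z0 : Pt d} (hz0 : z0 ∈ slab U) {K : Set (Pt d)} (hK : IsCompact K)
    (hKs : K ⊆ slab U) : ∃ C : ℝ, 0 < C ∧ ∀ u, IsSlabSolution U u → ∀ z ∈ K,
      u z ≤ C * u z0 ∧ u z0 ≤ C * u z := by
  have hpt : ∀ {a b : Pt d}, a ∈ slab U → b ∈ slab U →
      ∃ C : ℝ, 0 < C ∧ ∀ u, IsSlabSolution U u → u a ≤ C * u b := by
    intro a b ha hb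
    refine hU.isPreconnected_slab.induction₂'
      (fun a b => ∃ C : ℝ, 0 < C ∧ ∀ u, IsSlabSolution U u → u a ≤ C * u b) ?_ ?_ ha hb
    · intro x hx
      obtain ⟨V, hV, _, h⟩ := hU.exists_local_harnack hx
      filter_upwards [mem_nhdsWithin_of_mem_nhds hV] with y hy
      exact ⟨⟨_, by positivity, fun u hu => h u hu x (mem_of_mem_nhds hV) y hy⟩,
        ⟨_, by positivity, fun u hu => h u hu y hy x (mem_of_mem_nhds hV)⟩⟩
    · rintro x y z _ _ _ ⟨C, hC, h⟩ ⟨C', hC', h'⟩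
      refine ⟨C * C', by positivity, fun u hu => (h u hu).trans ?_⟩
      rw [mul_assoc]
      exact mul_le_mul_of_nonneg_left (h' u hu) hC.le
  suffices h : ∃ C : ℝ, 0 < C ∧ ∀ u, IsSlabSolution U u → ∀ z ∈ K, z ∈ slab U →
      u z ≤ C * u z0 ∧ u z0 ≤ C * u z by
    obtain ⟨C, hC, h⟩ := h
    exact ⟨C, hC, fun u hu z hz => h u hu z hz (hKs hz)⟩
  refine hK.induction_on (p := fun K => ∃ C : ℝ, 0 < C ∧ ∀ u, IsSlabSolution U u → ∀ z ∈ K,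
    z ∈ slab U → u z ≤ C * u z0 ∧ u z0 ≤ C * u z) ⟨1, one_pos, by simp⟩ ?_ ?_ ?_
  · rintro s t hst ⟨C, hC, h⟩
    exact ⟨C, hC, fun u hu z hz => h u hu z (hst hz)⟩
  · rintro s t ⟨C, hC, h⟩ ⟨C', hC', h'⟩
    refine ⟨C + C', by positivity, fun u hu z hz hzs => ?_⟩
    have h0 := mul_nonneg hC.le (hu.nonneg z0 hz0)
    have h1 := mul_nonneg hC.le (hu.nonneg z hzs)
    have h2 := mul_nonneg hC'.le (hu.nonneg z0 hz0)
    have h3 := mul_nonneg hC'.le (hu.nonneg z hzs)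
    rcases hz with hz | hz
    · obtain ⟨ha, hb⟩ := h u hu z hz hzs
      constructor <;> linarith
    · obtain ⟨ha, hb⟩ := h' u hu z hz hzs
      constructor <;> linarith
  · intro x hx
    obtain ⟨V, hV, hVs, h⟩ := hU.exists_local_harnack (hKs hx)
    obtain ⟨C, hC, h1⟩ := hpt (hKs hx) hz0
    obtain ⟨C', hC', h2⟩ := hpt hz0 (hKs hx)
    refine ⟨V, mem_nhdsWithin_of_mem_nhds hV, 2 ^ Module.finrank ℝ (Pt d) * (C + C'),
      by positivity, fun u hu z hz hzs => ?_⟩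
    have hxV := mem_of_mem_nhds hV
    have ha := h u hu z hz x hxV
    have hb := h u hu x hxV z hz
    have h0 := hu.nonneg z0 hz0
    have h3 := hu.nonneg z hzs
    set p : ℝ := 2 ^ Module.finrank ℝ (Pt d)
    have hp : 0 < p := by positivity
    constructor
    · calc u z ≤ p * u x := ha
        _ ≤ p * (C * u z0) := by gcongr; exact h1 u hu
        _ ≤ p * ((C + C') * u z0) := by gcongr; linarith
        _ = _ := by ring
    · calc u z0 ≤ C' * u x := h2 u hu
        _ ≤ C' * (p * u z) := by gcongr
        _ ≤ (C + C') * (p * u z) := by gcongr; linarith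
        _ = _ := by ring

end IsSmoothDomain

end Harnack

section IntegralBound

variable {d : ℕ} {U : Set (Fin (d+1) → ℝ)} {F : (Fin (d+1) → ℝ) → ℝ} {u : Pt d → ℝ} {ε : ℝ}

lemma slab_bound_near_lateral {q Q f C s : ℝ} (hQ : q ≤ Q) (h1 : f * C ≤ q / 2)
    (h2 : f ^ 2 ≤ q / 9) :
    s ^ 2 * (q / 4) ≤ 4 * (1 - s) * f ^ 2 + s ^ 2 * Q - s * f * (s * C + 2 * f) := by
  have ha : s ^ 2 * q ≤ s ^ 2 * Q := by gcongr
  have hb : s ^ 2 * (f * C) ≤ s ^ 2 * (q / 2) := by gcongr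
  have hc : 6 * s * f ^ 2 ≤ s ^ 2 * (q / 4) + 4 * f ^ 2 := by
    have h3 : s ^ 2 * f ^ 2 ≤ s ^ 2 * (q / 9) := by gcongr
    linarith [sq_nonneg (f * (3 * s / 2 - 2))]
  linarith

lemma slab_bound_near_end {Q f C s : ℝ} (hs : 0 ≤ s) (hs1 : s ≤ 1 / 2) (hf : 0 ≤ f) (hQ : 0 ≤ Q)
    (hC : s * C ≤ f) : 0 ≤ 4 * (1 - s) * f ^ 2 + s ^ 2 * Q - s * f * (s * C + 2 * f) := by
  have h2 : s * f * (s * C + 2 * f) ≤ s * f * (f + 2 * f) := by gcongr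
  have h3 : 0 ≤ s ^ 2 * Q := by positivity
  have h4 : s * f ^ 2 ≤ 1 / 2 * f ^ 2 := by gcongr
  linarith [sq_nonneg f]

namespace IsSmoothDomain

variable (hU : IsSmoothDomain U F)
include hU

/-- The closed subset of the slab cut out by lower bounds on `F` and `1 - x²` is compact. -/
lemma isCompact_core (δ s : ℝ) : IsCompact
    {z : Pt d | z.1 ∈ Icc (-1 : ℝ) 1 ∧ z.2 ∈ closure U ∧ δ ≤ F z.2 ∧ s ≤ 1 - z.1 ^ 2} := by
  refine ((isCompact_Icc (a := (-1 : ℝ)) (b := 1)).prod hU.isCompact_closure).of_isClosed_subset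
    ?_ fun z hz => ⟨hz.1, hz.2.1⟩
  have h1 : IsClosed {z : Pt d | z.1 ∈ Icc (-1 : ℝ) 1} := isClosed_Icc.preimage continuous_fst
  have h2 : IsClosed {z : Pt d | z.2 ∈ closure U} := isClosed_closure.preimage continuous_snd
  have h3 : IsClosed {z : Pt d | δ ≤ F z.2} :=
    isClosed_le continuous_const (hU.contDiff.continuous.comp continuous_snd)
  have h4 : IsClosed {z : Pt d | s ≤ 1 - z.1 ^ 2} := isClosed_le continuous_const (by fun_prop)
  exact h1.inter (h2.inter (h3.inter h4))

lemma core_subset_slab {δ s : ℝ} (hδ : 0 < δ) (hs : 0 < s) :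
    {z : Pt d | z.1 ∈ Icc (-1 : ℝ) 1 ∧ z.2 ∈ closure U ∧ δ ≤ F z.2 ∧ s ≤ 1 - z.1 ^ 2} ⊆
      slab U := by
  rintro z ⟨h1, h2, h3, h4⟩
  have h5 := abs_lt_of_sq_lt_sq' (a := z.1) (b := 1) (by linarith) one_pos.le
  exact ⟨h5, hU.mem_of_pos (hδ.trans_le h3)⟩

lemma exists_lap_bowl_bound : ∃ c M : ℝ, ∃ K : Set (Pt d), 0 < c ∧ 0 ≤ M ∧ IsCompact K ∧
    K ⊆ slab U ∧ ∀ ε > 0, ∀ z ∈ slab U,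
      {z : Pt d | |z.1| ≤ 1 / 2}.indicator (fun z => c * cut ε (slabHt F z)) z ≤
        lap (fun z => bowl ε (slabHt F z)) z + K.indicator (fun _ => M) z := by
  obtain ⟨q, C, hq, hC, hb⟩ := hU.exists_bounds
  set δ := min 1 (q / (9 + 2 * C)) with hδ_def
  have hδ : 0 < δ := by positivity
  have hδ1 : δ ≤ 1 := min_le_left _ _
  have hδq : δ * (9 + 2 * C) ≤ q := by
    rw [← le_div_iff₀ (by positivity)]; exact min_le_right _ _
  have hδC0 : 0 ≤ δ * C := by positivity
  have hδC : δ * C ≤ q / 2 := by linarith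
  have hδ9 : δ ≤ q / 9 := by linarith
  have hδ2 : δ ^ 2 ≤ δ := pow_le_of_le_one hδ.le hδ1 two_ne_zero
  set s0 := min (1 / 2) (δ / (C + 1)) with hs0_def
  have hs0 : 0 < s0 := by positivity
  have hs1 : s0 ≤ 1 / 2 := min_le_left _ _
  have hsδ : s0 * (C + 1) ≤ δ := by
    rw [← le_div_iff₀ (by positivity)]; exact min_le_right _ _
  refine ⟨q / 8, 3 * C ^ 2 + q / 8, _, by positivity, by positivity, hU.isCompact_core δ s0,
    hU.core_subset_slab hδ hs0, fun ε hε z hz => ?_⟩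
  obtain ⟨hbg, hbl, hbF⟩ := hb z (subset_closure hz.2)
  have hF := hU.pos hz.2
  have hg := hU.slabHt_pos hz
  have hx := hz.1
  set s := 1 - z.1 ^ 2 with hs_def
  have hs : 0 < s := by nlinarith [hx.1, hx.2]
  have hsle : s ≤ 1 := by nlinarith [sq_nonneg z.1]
  have hgeq : slabHt F z = s * F z.2 := rfl
  rw [lap_comp hU.contDiff_slabHt.contDiffAt (hasDerivAt_bowl ε) (hasDerivAt_ramp ε _)]
  have hcut0 := cut_nonneg ε (slabHt F z)
  have hcut1 := cut_le_one ε (slabHt F z)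
  have hr0 := ramp_nonneg hε (slabHt F z)
  have hr1 := ramp_le_mul_cut hε hg.le
  set κ := cut ε (slabHt F z)
  set ρ := ramp ε (slabHt F z)
  have hlg := hU.lap_slabHt z
  have hgg := hU.gradSq_slabHt z
  rw [← hs_def] at hlg hgg
  set L := lap (lift F) z
  set Q := gradSq (lift F) z
  have hQ : 0 ≤ Q := gradSq_nonneg _ _
  set f := F z.2
  have hL := abs_le.1 hbl
  have hlow : κ * (gradSq (slabHt F) z - s * f * (s * C + 2 * f)) ≤
      κ * gradSq (slabHt F) z + ρ * lap (slabHt F) z := by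
    have h1 : -(s * C + 2 * f) ≤ lap (slabHt F) z := by
      rw [hlg]; nlinarith
    have h2 : ρ * (s * C + 2 * f) ≤ s * f * κ * (s * C + 2 * f) := by gcongr; exact hr1
    nlinarith
  refine le_trans ?_ (add_le_add_left hlow _)
  have hgg' : gradSq (slabHt F) z = 4 * (1 - s) * f ^ 2 + s ^ 2 * Q := by
    rw [hgg, hs_def]; ring
  rw [hgg']
  have hind : {z : Pt d | |z.1| ≤ 1 / 2}.indicator
      (fun z => q / 8 * cut ε (slabHt F z)) z ≤ q / 8 * κ :=
    indicator_le_self' (fun _ _ => mul_nonneg (by positivity) (cut_nonneg _ _)) z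
  by_cases hK : δ ≤ f ∧ s0 ≤ s
  · rw [indicator_of_mem (show z ∈ {z : Pt d | z.1 ∈ Icc (-1 : ℝ) 1 ∧ z.2 ∈ closure U ∧
      δ ≤ F z.2 ∧ s0 ≤ 1 - z.1 ^ 2} from ⟨Ioo_subset_Icc_self hx, subset_closure hz.2, hK⟩)]
    have h1 : s * f * (s * C + 2 * f) ≤ 3 * C ^ 2 := by
      calc s * f * (s * C + 2 * f) ≤ 1 * C * (1 * C + 2 * C) := by gcongr
        _ = _ := by ring
    have h2 : 0 ≤ 4 * (1 - s) * f ^ 2 + s ^ 2 * Q := by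
      have : 0 ≤ 1 - s := by linarith
      positivity
    have h3 : κ * (-(3 * C ^ 2)) ≤
        κ * (4 * (1 - s) * f ^ 2 + s ^ 2 * Q - s * f * (s * C + 2 * f)) := by
      gcongr; linarith
    nlinarith [mul_nonneg (sub_nonneg.2 hcut1) (sq_nonneg C)]
  · rw [indicator_of_notMem (s := {z : Pt d | z.1 ∈ Icc (-1 : ℝ) 1 ∧ z.2 ∈ closure U ∧
      δ ≤ F z.2 ∧ s0 ≤ 1 - z.1 ^ 2}) (fun h => hK h.2.2), add_zero]
    by_cases hfδ : f < δ
    · have hfq : f ≤ q := by linarith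
      have hQq := hbg hfq
      have h1 : f * C ≤ q / 2 := (mul_le_mul_of_nonneg_right hfδ.le hC).trans hδC
      have h2 : f ^ 2 ≤ q / 9 := (pow_le_pow_left₀ hF.le hfδ.le 2).trans (hδ2.trans hδ9)
      have h3 := slab_bound_near_lateral hQq h1 h2 (s := s)
      by_cases hxh : |z.1| ≤ 1 / 2
      · refine hind.trans ?_
        rw [mul_comm]
        have hs34 : 3 / 4 ≤ s := by
          have := sq_le_sq' (abs_le.1 hxh).1 (abs_le.1 hxh).2
          linarith
        have hs2 : (3 / 4) ^ 2 ≤ s ^ 2 := by gcongr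
        have hs3 : (3 / 4) ^ 2 * (q / 4) ≤ s ^ 2 * (q / 4) := by gcongr
        exact mul_le_mul_of_nonneg_left (by linarith) hcut0
      · rw [indicator_of_notMem (by exact hxh)]
        exact mul_nonneg hcut0 (le_trans (by positivity) h3)
    · have hss : s < s0 := by
        by_contra! h
        exact hK ⟨not_lt.1 hfδ, h⟩
      rw [not_lt] at hfδ
      have hsC : s * C ≤ f := by
        have : s * C ≤ s0 * C := by gcongr
        linarith
      rw [indicator_of_notMem]
      · exact mul_nonneg hcut0 (slab_bound_near_end hs.le (hss.le.trans hs1) hF.le hQ hsC)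
      · intro h
        have h' := abs_le.1 (show |z.1| ≤ 1 / 2 from h)
        have := sq_le_sq' h'.1 h'.2
        linarith

/-- Uniform integral bound for slab solutions in the half-slab. -/
lemma exists_integral_bound {z0 : Pt d} (hz0 : z0 ∈ slab U) : ∃ C : ℝ, 0 < C ∧
    ∀ u, IsSlabSolution U u → ∀ ε > 0,
      ∫ z, (slab U ∩ {z : Pt d | |z.1| ≤ 1 / 2}).indicator (fun z => u z * cut ε (slabHt F z)) z ≤
        C * u z0 := by
  obtain ⟨c, M, K, hc, hM, hK, hKs, hlap⟩ := hU.exists_lap_bowl_bound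
  obtain ⟨C, hC, hH⟩ := hU.exists_harnack hz0 hK hKs
  refine ⟨M * C * volume.real K / c + 1, by positivity, fun u hu ε hε => ?_⟩
  have hε4 : 0 < ε / 4 := by positivity
  set v := cutOff U F (ε / 4) u
  set G := (slab U).indicator fun z => bowl ε (slabHt F z)
  have hv2 : ContDiff ℝ 2 v := hu.contDiff_cutOff hU hε4
  have hvc : HasCompactSupport v := IsSlabSolution.hasCompactSupport_cutOff hU
  have hG2 : ContDiff ℝ 2 G := by
    refine contDiff_indicator hU.isOpen_slab
      (fun z _ => ((contDiff_bowl ε).comp hU.contDiff_slabHt).contDiffAt) fun z hz => ?_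
    filter_upwards [hU.eventually_slabHt_lt hε hz] with z' h' hz'
    exact bowl_of_le hε (h' hz').le
  have hGc : HasCompactSupport G := hasCompactSupport_indicator hU.isBounded_slab _
  have hzero : ∫ z, v z * lap G z = 0 := by
    rw [integral_mul_lap hv2 hG2 hvc hGc]
    refine integral_eq_zero_of_ae (Eventually.of_forall fun z => ?_)
    by_cases hz : z ∈ slab U
    · rcases le_or_gt (slabHt F z) ε with h | h
      · simp only [G, indicator_of_mem hz, bowl_of_le hε h, zero_mul, Pi.zero_apply]
      · have h0 : lap v z = 0 := hu.lap_cutOff hU hε4 hz (by linarith)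
        simp only [h0, mul_zero, Pi.zero_apply]
    · simp only [G, indicator_of_notMem hz, zero_mul, Pi.zero_apply]
  have hpt : ∀ z, c * (slab U ∩ {z : Pt d | |z.1| ≤ 1 / 2}).indicator
      (fun z => u z * cut ε (slabHt F z)) z ≤
        v z * lap G z + K.indicator (fun _ => M * (C * u z0)) z := by
    intro z
    by_cases hz : z ∈ slab U
    · have h1 := hlap ε hε z hz
      have h2 : lap G z = lap (fun z => bowl ε (slabHt F z)) z :=
        lap_congr (indicator_eventuallyEq_of_isOpen hU.isOpen_slab _ hz)
      have hv0 : 0 ≤ v z := hu.cutOff_nonneg z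
      have h3 := mul_le_mul_of_nonneg_left h1 hv0
      rw [← h2, mul_add] at h3
      have h4 : v z * K.indicator (fun _ => M) z ≤ K.indicator (fun _ => M * (C * u z0)) z := by
        by_cases hzK : z ∈ K
        · rw [indicator_of_mem hzK, indicator_of_mem hzK, mul_comm]
          gcongr
          exact (hu.cutOff_le hz).trans (hH u hu z hzK).1
        · rw [indicator_of_notMem hzK, indicator_of_notMem hzK, mul_zero]
      refine le_trans (le_of_eq ?_) (h3.trans (add_le_add_right h4 _))
      by_cases hx : |z.1| ≤ 1 / 2
      · rw [indicator_of_mem (show z ∈ slab U ∩ {z : Pt d | |z.1| ≤ 1 / 2} from ⟨hz, hx⟩),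
          indicator_of_mem (show z ∈ {z : Pt d | |z.1| ≤ 1 / 2} from hx)]
        rcases le_or_gt (slabHt F z) ε with h | h
        · simp only [cut_of_le hε h, mul_zero]
        · have : v z = u z :=
            (IsSlabSolution.cutOff_eventuallyEq hU hε4 hz (by linarith)).eq_of_nhds
          rw [this]; ring
      · rw [indicator_of_notMem (fun h => hx h.2),
          indicator_of_notMem (show z ∉ {z : Pt d | |z.1| ≤ 1 / 2} from hx), mul_zero, mul_zero]
    · have hv0 : v z = 0 := indicator_of_notMem hz _
      rw [indicator_of_notMem (fun h => hz h.1), indicator_of_notMem (fun h => hz (hKs h)), hv0]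
      simp
  have hi1 : Integrable fun z => v z * lap G z :=
    (hv2.continuous.mul (continuous_lap hG2)).integrable_of_hasCompactSupport hvc.mul_right
  have hi2 : Integrable (K.indicator fun _ => M * (C * u z0)) :=
    (integrable_indicator_iff hK.measurableSet).2
      (integrableOn_const hK.measure_lt_top.ne)
  have h := integral_mono_of_nonneg (Eventually.of_forall fun z => mul_nonneg hc.le
    (indicator_nonneg (fun z hz => mul_nonneg (hu.nonneg z hz.1) (cut_nonneg _ _)) z))
    (hi1.add hi2) (Eventually.of_forall hpt)
  simp only [Pi.add_apply] at h
  rw [integral_const_mul, integral_add hi1 hi2, hzero, zero_add,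
    integral_indicator hK.measurableSet, setIntegral_const, smul_eq_mul] at h
  have h0 := hu.nonneg z0 hz0
  rw [add_mul, div_mul_eq_mul_div, one_mul]
  refine le_add_of_le_of_nonneg ?_ h0
  rw [le_div_iff₀ hc]
  linarith

end IsSmoothDomain

end IntegralBound

section SupBound

variable {d : ℕ} {U : Set (Fin (d+1) → ℝ)} {F : (Fin (d+1) → ℝ) → ℝ} {u : Pt d → ℝ} {η : ℝ}

/-- A smooth truncation of a slab solution, subharmonic in the half-slab. -/
def slabTrunc (U : Set (Fin (d+1) → ℝ)) (η : ℝ) (u : Pt d → ℝ) : Pt d → ℝ :=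
  (slab U).indicator fun z => ramp η (u z) * cut (3/8) (1 - z.1 ^ 2)

namespace IsSlabSolution

variable (hU : IsSmoothDomain U F) (hu : IsSlabSolution U u)
include hU hu

lemma eventually_slabTrunc (hη : 0 < η) {z : Pt d} (hz : z ∉ slab U) :
    ∀ᶠ z' in nhds z, z' ∈ slab U → ramp η (u z') * cut (3/8) (1 - z'.1 ^ 2) = 0 := by
  by_cases h : z.2 ∈ U
  · have h1 : 1 - z.1 ^ 2 < 3 / 8 := by
      by_contra! hc
      exact hz ⟨abs_lt_of_sq_lt_sq' (a := z.1) (b := 1) (by linarith) one_pos.le, h⟩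
    have hc : Continuous fun z : Pt d => 1 - z.1 ^ 2 := by fun_prop
    filter_upwards [hc.continuousAt.eventually_lt_const h1] with z' hz' _
    rw [cut_of_le (by norm_num) hz'.le, mul_zero]
  · by_cases hc : z ∈ closure (slab U)
    · rw [IsSmoothDomain.closure_slab] at hc
      have h0 : u z = 0 := hu.eq_zero z hc.1 (by rw [hU.isOpen.frontier_eq]; exact ⟨hc.2, h⟩)
      have h1 := (hu.continuousOn z hc).eventually_lt_const (show u z < η by rwa [h0])
      rw [eventually_nhdsWithin_iff] at h1
      filter_upwards [h1] with z' hz' hs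
      rw [ramp_of_le hη (hz' ⟨Ioo_subset_Icc_self hs.1, subset_closure hs.2⟩).le, zero_mul]
    · filter_upwards [isClosed_closure.isOpen_compl.mem_nhds hc] with z' h1 h2
      exact absurd (subset_closure h2) h1

lemma contDiff_slabTrunc (hη : 0 < η) : ContDiff ℝ 2 (slabTrunc U η u) :=
  contDiff_indicator hU.isOpen_slab (fun z hz =>
    ((contDiff_ramp η).contDiffAt.comp z (hu.contDiffAt z hz)).mul
      (((contDiff_cut _ (n := 2)).comp (contDiff_const.sub (contDiff_fst.pow 2))).contDiffAt))
    fun _ hz => hu.eventually_slabTrunc hU hη hz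

omit hu in
lemma hasCompactSupport_slabTrunc : HasCompactSupport (slabTrunc U η u) :=
  hasCompactSupport_indicator hU.isBounded_slab _

omit hU hu in
lemma slabTrunc_nonneg (hη : 0 < η) (z : Pt d) : 0 ≤ slabTrunc U η u z :=
  indicator_nonneg (fun _ _ => mul_nonneg (ramp_nonneg hη _) (cut_nonneg _ _)) z

omit hU hu in
lemma slabTrunc_eq {z : Pt d} (hz : z ∈ slab U) (hx : |z.1| ≤ 1 / 2) :
    slabTrunc U η u z = ramp η (u z) := by
  have := sq_le_sq' (abs_le.1 hx).1 (abs_le.1 hx).2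
  rw [slabTrunc, indicator_of_mem hz, cut_of_ge (by norm_num) (by linarith), mul_one]

lemma lap_slabTrunc_nonneg (hη : 0 < η) {z : Pt d} (hx : |z.1| < 1 / 2) :
    0 ≤ lap (slabTrunc U η u) z := by
  by_cases hz : z ∈ slab U
  · have h : slabTrunc U η u =ᶠ[nhds z] fun z => ramp η (u z) := by
      have hc : Continuous fun z : Pt d => |z.1| := by fun_prop
      filter_upwards [hU.isOpen_slab.mem_nhds hz, hc.continuousAt.eventually_lt_const hx]
        with z' h1 h2
      exact slabTrunc_eq h1 h2.le
    rw [lap_congr h, lap_comp (hu.contDiffAt z hz) (hasDerivAt_ramp η) (hasDerivAt_cut η _),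
      hu.lap_eq z hz, mul_zero, add_zero]
    exact mul_nonneg (deriv_cut_nonneg hη _) (gradSq_nonneg _ _)
  · have h : slabTrunc U η u =ᶠ[nhds z] fun _ => 0 := by
      filter_upwards [hu.eventually_slabTrunc hU hη hz] with z' h1
      by_cases h' : z' ∈ slab U
      · rw [slabTrunc, indicator_of_mem h', h1 h']
      · rw [slabTrunc, indicator_of_notMem h']
    rw [lap_congr h, lap_const]

lemma slabTrunc_mul_integral_kern_le (hη : 0 < η) {z : Pt d} (hx : |z.1| ≤ 1 / 4) :
    slabTrunc U η u z * ∫ y : Pt d, kern y ≤ 4 ^ Module.finrank ℝ (Pt d) *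
      ∫ y, slabTrunc U η u y * kern ((4 : ℝ) • (y - z)) := by
  have h := mul_integral_kern_le (hu.contDiff_slabTrunc hU hη) (z := z) (R := 4⁻¹) (by norm_num)
    fun z' hz' => hu.lap_slabTrunc_nonneg hU hη (by
      have h1 : (z'.1 - z.1) ^ 2 < 4⁻¹ ^ 2 := (sq_coord_le_normSq (z' - z) none).trans_lt hz'
      have h2 := abs_lt_of_sq_lt_sq h1 (by norm_num)
      calc |z'.1| = |z'.1 - z.1 + z.1| := by rw [sub_add_cancel]
        _ ≤ |z'.1 - z.1| + |z.1| := abs_add_le _ _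
        _ < 4⁻¹ + 1 / 4 := by linarith
        _ = 1 / 2 := by norm_num)
  simpa only [inv_inv, ← inv_pow] using h

omit hU hu in
lemma slabTrunc_mul_kern_eq_zero {y z : Pt d} (hx : |z.1| ≤ 1 / 4) (hy : 1 / 2 < |y.1|) :
    slabTrunc U η u y * kern ((4 : ℝ) • (y - z)) = 0 := by
  rw [kern_eq_zero, mul_zero]
  rw [normSq_smul]
  have h1 : (y.1 - z.1) ^ 2 ≤ normSq (y - z) := sq_coord_le_normSq (y - z) none
  have h2 : 1 / 4 ≤ |y.1 - z.1| := by
    have := abs_sub_abs_le_abs_sub y.1 z.1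
    linarith
  have h3 : (1 / 4) ^ 2 ≤ |y.1 - z.1| ^ 2 := by gcongr
  rw [sq_abs] at h3
  linarith

end IsSlabSolution

namespace IsSmoothDomain

variable (hU : IsSmoothDomain U F)
include hU

/-- Slab solutions are bounded in the quarter-slab by their value at an interior point. -/
theorem exists_sup_bound {z0 : Pt d} (hz0 : z0 ∈ slab U) : ∃ C : ℝ, 0 < C ∧
    ∀ u, IsSlabSolution U u → ∀ z ∈ slab U, |z.1| ≤ 1 / 4 → u z ≤ C * u z0 := by
  obtain ⟨C, hC, hI⟩ := hU.exists_integral_bound hz0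
  have hk : 0 < ∫ y : Pt d, kern y := integral_kern_pos
  refine ⟨4 ^ Module.finrank ℝ (Pt d) * C / ∫ y : Pt d, kern y, by positivity,
    fun u hu z hz hx => ?_⟩
  refine le_of_forall_pos_le_add fun η' hη' => ?_
  set η := η' / 2 with hη_def
  have hη : 0 < η := by positivity
  have h1 := hu.slabTrunc_mul_integral_kern_le hU hη hx
  rw [IsSlabSolution.slabTrunc_eq hz (by linarith)] at h1
  have h2 := sub_le_ramp hη (u z)
  obtain ⟨ε, hε, hmin⟩ : ∃ ε > 0, ∀ y ∈ slab U, |y.1| ≤ 1 / 2 → η ≤ u y → 2 * ε ≤ slabHt F y := by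
    set K0 : Set (Pt d) := Icc (-(1 / 2)) (1 / 2) ×ˢ closure U with hK0
    have hK0c : IsCompact K0 := isCompact_Icc.prod hU.isCompact_closure
    have hsub : K0 ⊆ Icc (-1) 1 ×ˢ closure U :=
      prod_mono (Icc_subset_Icc (by norm_num) (by norm_num)) subset_rfl
    have hK : IsCompact (K0 ∩ u ⁻¹' Ici η) := hK0c.of_isClosed_subset
      ((hu.continuousOn.mono hsub).preimage_isClosed_of_isClosed hK0c.isClosed isClosed_Ici)
      inter_subset_left
    obtain ⟨a, ha, hmin⟩ := hK.exists_forall_le' (a := 0)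
      hU.contDiff_slabHt.continuous.continuousOn (by
        rintro y ⟨hy, hyη⟩
        refine hU.slabHt_pos ⟨⟨by linarith [hy.1.1], by linarith [hy.1.2]⟩, ?_⟩
        by_contra h
        have : u y = 0 := hu.eq_zero y (hsub hy).1 (by rw [hU.isOpen.frontier_eq]; exact ⟨hy.2, h⟩)
        rw [mem_preimage, this] at hyη
        exact absurd hη (not_lt.2 hyη))
    exact ⟨a / 2, by positivity, fun y hy hyx hyη => by
      rw [mul_div_cancel₀ _ two_ne_zero]
      exact hmin y ⟨⟨abs_le.1 hyx, subset_closure hy.2⟩, hyη⟩⟩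
  have hle : ∫ y, slabTrunc U η u y * kern ((4 : ℝ) • (y - z)) ≤ C * u z0 := by
    refine le_trans (integral_mono_of_nonneg (Eventually.of_forall fun y => mul_nonneg
      (IsSlabSolution.slabTrunc_nonneg hη y) (kern_nonneg _)) ?_ (Eventually.of_forall fun y => ?_))
      (hI u hu ε hε)
    · have hm : MeasurableSet {z : Pt d | |z.1| ≤ 1 / 2} :=
        (isClosed_le (by fun_prop) continuous_const).measurableSet
      rw [inter_comm, ← indicator_indicator]
      exact ((hu.contDiff_cutOff hU hε).continuous.integrable_of_hasCompactSupport
        (IsSlabSolution.hasCompactSupport_cutOff hU)).indicator hm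
    · have hnn : 0 ≤ (slab U ∩ {z : Pt d | |z.1| ≤ 1 / 2}).indicator
          (fun z => u z * cut ε (slabHt F z)) y :=
        indicator_nonneg (fun z hz => mul_nonneg (hu.nonneg z hz.1) (cut_nonneg _ _)) y
      beta_reduce
      by_cases hy : y ∈ slab U
      · by_cases hyx : |y.1| ≤ 1 / 2
        · rcases le_or_gt (u y) η with hyη | hyη
          · rwa [IsSlabSolution.slabTrunc_eq hy hyx, ramp_of_le hη hyη, zero_mul]
          · rw [indicator_of_mem (show y ∈ slab U ∩ {z : Pt d | |z.1| ≤ 1 / 2} from ⟨hy, hyx⟩),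
              cut_of_ge hε (hmin y hy hyx hyη.le), mul_one, IsSlabSolution.slabTrunc_eq hy hyx]
            have h0 := hu.nonneg y hy
            refine (mul_le_of_le_one_right (ramp_nonneg hη _) (kern_le_one _)).trans
              ((ramp_le_mul_cut hη h0).trans (mul_le_of_le_one_right h0 (cut_le_one _ _)))
        · rwa [IsSlabSolution.slabTrunc_mul_kern_eq_zero hx (not_le.1 hyx)]
      · rw [slabTrunc, indicator_of_notMem hy, zero_mul]
        exact hnn
  have h3 : ramp η (u z) ≤ 4 ^ Module.finrank ℝ (Pt d) * C / (∫ y : Pt d, kern y) * u z0 := by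
    rw [div_mul_eq_mul_div, le_div_iff₀ hk, mul_assoc]
    exact h1.trans (by gcongr)
  linarith

end IsSmoothDomain

end SupBound

section BoundaryHarnack

variable {d : ℕ} {U : Set (Fin (d+1) → ℝ)} {F : (Fin (d+1) → ℝ) → ℝ} {u : Pt d → ℝ}

/-- The defining function with a quadratic perturbation in the axial direction. -/
def tilt (F : (Fin (d+1) → ℝ) → ℝ) (k : ℝ) (z : Pt d) : ℝ := lift F z + k * z.1 ^ 2

/-- The part of the slab of half-width `x₀` close to the lateral boundary. -/
def collar (U : Set (Fin (d+1) → ℝ)) (F : (Fin (d+1) → ℝ) → ℝ) (x₀ δ : ℝ) : Set (Pt d) :=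
  {z | z.1 ∈ Ioo (-x₀) x₀ ∧ z.2 ∈ U ∧ F z.2 < δ}

lemma contDiff_tilt (hF : ContDiff ℝ 2 F) (k : ℝ) : ContDiff ℝ 2 (tilt F k) :=
  (hF.comp contDiff_snd).add (contDiff_const.mul (contDiff_fst.pow 2))

lemma contDiff_exp_tilt (hF : ContDiff ℝ 2 F) (a k : ℝ) :
    ContDiff ℝ 2 fun z : Pt d => Real.exp (a * tilt F k z) :=
  (contDiff_const.mul (contDiff_tilt hF k)).exp

lemma lap_exp_tilt_nonneg (hF : ContDiff ℝ 2 F) {a k q C : ℝ} {z : Pt d}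
    (hg : q ≤ gradSq (lift F) z) (hl : |lap (lift F) z| ≤ C) (ha : C + 2 * |k| ≤ |a| * q) :
    0 ≤ lap (fun z => Real.exp (a * tilt F k z)) z := by
  have h1 : ∀ t : ℝ, HasDerivAt (fun t => Real.exp (a * t)) (a * Real.exp (a * t)) t := by
    intro t
    have := ((hasDerivAt_id t).const_mul a).exp
    simpa [mul_comm] using this
  rw [lap_comp (φ := fun t => Real.exp (a * t)) (contDiff_tilt hF k).contDiffAt h1
    ((h1 _).const_mul a)]
  have hG : q ≤ gradSq (tilt F k) z := hg.trans (IsSmoothDomain.gradSq_lift_add hF k z)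
  have hL : lap (tilt F k) z = lap (lift F) z + 2 * k := IsSmoothDomain.lap_lift_add hF k z
  have hL' : |lap (tilt F k) z| ≤ |a| * q := by
    rw [hL]
    refine (abs_add_le _ _).trans (le_trans ?_ ha)
    rw [abs_mul, abs_two]
    gcongr
  have h2 : -(a * lap (tilt F k) z) ≤ a * a * gradSq (tilt F k) z := by
    calc -(a * lap (tilt F k) z) ≤ |a * lap (tilt F k) z| := neg_le_abs _
      _ = |a| * |lap (tilt F k) z| := abs_mul _ _
      _ ≤ |a| * (|a| * q) := by gcongr
      _ = a * a * q := by rw [← mul_assoc, abs_mul_abs_self]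
      _ ≤ a * a * gradSq (tilt F k) z := mul_le_mul_of_nonneg_left hG (mul_self_nonneg a)
  have h3 : a * (a * Real.exp (a * tilt F k z)) * gradSq (tilt F k) z
      + a * Real.exp (a * tilt F k z) * lap (tilt F k) z
      = Real.exp (a * tilt F k z) * (a * a * gradSq (tilt F k) z + a * lap (tilt F k) z) := by ring
  rw [h3]
  exact mul_nonneg (Real.exp_pos _).le (by linarith)

namespace IsSmoothDomain

variable (hU : IsSmoothDomain U F)
include hU

lemma mem_or_mem_frontier {y} (hy : y ∈ closure U) : y ∈ U ∨ y ∈ frontier U := by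
  by_cases h : y ∈ U
  · exact Or.inl h
  · exact Or.inr (by rw [hU.isOpen.frontier_eq]; exact ⟨hy, h⟩)

/-- The maximum principle on a collar. -/
lemma nonpos_of_subharmonic_collar {x₀ δ : ℝ} (hx₁ : x₀ ≤ 1) {h : Pt d → ℝ}
    (hc : ContinuousOn h (Icc (-1) 1 ×ˢ closure U))
    (hC : ∀ z ∈ collar U F x₀ δ, ContDiffAt ℝ 2 h z) (hl : ∀ z ∈ collar U F x₀ δ, 0 ≤ lap h z)
    (hb : ∀ z : Pt d, z.1 ∈ Icc (-x₀) x₀ → z.2 ∈ frontier U → h z ≤ 0)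
    (hb' : ∀ z : Pt d, z.1 ∈ Icc (-x₀) x₀ → z.2 ∈ U → F z.2 ≤ δ →
      (z.1 ^ 2 = x₀ ^ 2 ∨ F z.2 = δ) → h z ≤ 0) :
    ∀ z ∈ collar U F x₀ δ, h z ≤ 0 := by
  have ho : IsOpen (collar U F x₀ δ) :=
    (isOpen_Ioo.preimage continuous_fst).inter ((hU.isOpen.preimage continuous_snd).inter
      (isOpen_lt (hU.contDiff.continuous.comp continuous_snd) continuous_const))
  have hcl : closure (collar U F x₀ δ) ⊆
      {z | z.1 ∈ Icc (-x₀) x₀ ∧ z.2 ∈ closure U ∧ F z.2 ≤ δ} := by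
    refine closure_minimal (fun z hz => ⟨Ioo_subset_Icc_self hz.1, subset_closure hz.2.1, hz.2.2.le⟩)
      ?_
    exact (isClosed_Icc.preimage continuous_fst).inter ((isClosed_closure.preimage
      continuous_snd).inter (isClosed_le (hU.contDiff.continuous.comp continuous_snd)
      continuous_const))
  refine nonpos_of_subharmonic ho ?_ (hc.mono ?_) hC hl ?_
  · refine ((Metric.isBounded_Ioo (-x₀) x₀).prod hU.isBounded).subset fun z hz => ⟨hz.1, hz.2.1⟩
  · intro z hz
    have h1 := hcl hz
    exact ⟨⟨by linarith [h1.1.1], by linarith [h1.1.2]⟩, h1.2.1⟩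
  · intro z hz
    rw [ho.frontier_eq] at hz
    obtain ⟨h1, h2, h3⟩ := hcl hz.1
    rcases hU.mem_or_mem_frontier h2 with h4 | h4
    · refine hb' z h1 h4 h3 ?_
      by_contra! hne
      refine hz.2 ⟨⟨lt_of_le_of_ne h1.1 ?_, lt_of_le_of_ne h1.2 ?_⟩, h4, lt_of_le_of_ne h3 hne.2⟩
      · intro h5; exact hne.1 (by rw [← h5]; ring)
      · intro h5; exact hne.1 (by rw [h5])
    · exact hb z h1 h4

lemma exists_upper_barrier {z0 : Pt d} (hz0 : z0 ∈ slab U) : ∃ C : ℝ, 0 < C ∧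
    ∀ u, IsSlabSolution U u → ∀ y ∈ U, u (0, y) ≤ C * u z0 * F y := by
  obtain ⟨q, C, hq, hC, hb⟩ := hU.exists_bounds
  obtain ⟨M, hM, hsup⟩ := hU.exists_sup_bound hz0
  set A := (C + 32 * q) / q with hA
  have hA0 : 0 < A := by positivity
  have hAq : A * q = C + 32 * q := by rw [hA]; field_simp
  set e := 1 - Real.exp (-A * q) with he
  have he0 : 0 < e := by
    have : Real.exp (-A * q) < 1 := Real.exp_lt_one_iff.2 (by rw [neg_mul]; exact neg_neg_of_pos (mul_pos hA0 hq))
    rw [he]; linarith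
  refine ⟨M / q + M / e * A, by positivity, fun u hu y hy => ?_⟩
  have hu0 : 0 ≤ u z0 := hu.nonneg z0 hz0
  have hF0 : 0 < F y := hU.pos hy
  have h0y : ((0, y) : Pt d) ∈ slab U := ⟨by norm_num, hy⟩
  have hs : M / q * u z0 * F y + M / e * A * u z0 * F y = (M / q + M / e * A) * u z0 * F y := by ring
  rw [← hs]
  have hp1 : 0 ≤ M / q * u z0 * F y := by positivity
  have hp2 : 0 ≤ M / e * A * u z0 * F y := by positivity
  by_cases hFy : q ≤ F y
  · have h1 : u (0, y) ≤ M * u z0 := hsup u hu _ h0y (by norm_num)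
    have h2 : M * u z0 ≤ M / q * u z0 * F y := by
      calc M * u z0 = M / q * u z0 * q := by field_simp
        _ ≤ _ := by gcongr
    linarith
  push Not at hFy
  have hm0 : 0 ≤ M * u z0 / e := by positivity
  have hmain : ∀ z ∈ collar U F (1 / 4) q,
      u z - (M * u z0 / e) * (1 - Real.exp (-A * tilt F (16 * q) z)) ≤ 0 := by
    have hg := contDiff_exp_tilt (d := d) hU.contDiff (-A) (16 * q)
    have hsl : ∀ z ∈ collar U F (1 / 4) q, z ∈ slab U := fun z hz =>
      ⟨⟨by linarith [hz.1.1], by linarith [hz.1.2]⟩, hz.2.1⟩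
    have hg2 : ContDiff ℝ 2 fun z : Pt d =>
        M * u z0 / e * (1 - Real.exp (-A * tilt F (16 * q) z)) :=
      contDiff_const.mul (contDiff_const.sub hg)
    refine hU.nonpos_of_subharmonic_collar (by norm_num)
      (hu.continuousOn.sub hg2.continuous.continuousOn) ?_ ?_ ?_ ?_
    · exact fun z hz => (hu.contDiffAt z (hsl z hz)).sub hg2.contDiffAt
    · intro z hz
      have hb1 := hb z (subset_closure hz.2.1)
      have h1 := lap_exp_tilt_nonneg (a := -A) (k := 16 * q) hU.contDiff (hb1.1 hz.2.2.le) hb1.2.1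
        (by rw [abs_neg, abs_of_pos hA0, hAq, abs_of_pos (by positivity)]; linarith)
      rw [lap_sub (hu.contDiffAt z (hsl z hz)) hg2.contDiffAt,
        lap_const_mul (contDiff_const.sub hg).contDiffAt, lap_sub contDiffAt_const hg.contDiffAt,
        lap_const, hu.lap_eq z (hsl z hz)]
      have := mul_nonneg hm0 h1
      linarith
    · intro z hx hy
      rw [hu.eq_zero z ⟨by linarith [hx.1], by linarith [hx.2]⟩ hy]
      have h1 : 0 ≤ tilt F (16 * q) z := by
        rw [tilt, lift, hU.eq_zero hy]; positivity
      have h2 : Real.exp (-A * tilt F (16 * q) z) ≤ 1 := Real.exp_le_one_iff.2 (by nlinarith)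
      have := mul_nonneg hm0 (sub_nonneg.2 h2)
      linarith
    · intro z hx hy hF hor
      have hF0 := hU.pos hy
      have h1 : u z ≤ M * u z0 := hsup u hu _ ⟨⟨by linarith [hx.1], by linarith [hx.2]⟩, hy⟩
        (abs_le.2 ⟨by linarith [hx.1], hx.2⟩)
      have h2 : q ≤ tilt F (16 * q) z := by
        rw [tilt, lift]
        rcases hor with h | h
        · rw [h]; linarith
        · rw [h]; have := mul_nonneg hq.le (sq_nonneg z.1); linarith
      have h3 : Real.exp (-A * tilt F (16 * q) z) ≤ Real.exp (-A * q) :=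
        Real.exp_le_exp.2 (by nlinarith)
      have h4 : M * u z0 / e * e ≤ M * u z0 / e * (1 - Real.exp (-A * tilt F (16 * q) z)) := by
        apply mul_le_mul_of_nonneg_left _ hm0
        rw [he]; linarith
      have h5 : M * u z0 / e * e = M * u z0 := by field_simp
      linarith
  have h1 := hmain (0, y) ⟨by norm_num, hy, hFy⟩
  have h2 : tilt F (16 * q) (0, y) = F y := by simp [tilt, lift]
  rw [h2] at h1
  have h3 : 1 - Real.exp (-A * F y) ≤ A * F y := by
    have := Real.add_one_le_exp (-A * F y)
    linarith
  have h4 : M * u z0 / e * (1 - Real.exp (-A * F y)) ≤ M * u z0 / e * (A * F y) :=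
    mul_le_mul_of_nonneg_left h3 hm0
  have h5 : M * u z0 / e * (A * F y) = M / e * A * u z0 * F y := by ring
  linarith

lemma exists_lower_barrier {z0 : Pt d} (hz0 : z0 ∈ slab U) : ∃ c : ℝ, 0 < c ∧
    ∀ u, IsSlabSolution U u → ∀ y ∈ U, c * u z0 * F y ≤ u (0, y) := by
  obtain ⟨q, C, hq, hC, hb⟩ := hU.exists_bounds
  obtain ⟨H, hH, hHar⟩ := hU.exists_harnack hz0 (hU.isCompact_core q (3 / 4))
    (hU.core_subset_slab hq (by norm_num))
  set A := (C + 32 * q) / q with hA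
  have hA0 : 0 < A := by positivity
  have hAq : A * q = C + 32 * q := by rw [hA]; field_simp
  set e := Real.exp (A * q) - 1 with he
  have he0 : 0 < e := by
    have : 1 < Real.exp (A * q) := Real.one_lt_exp_iff.2 (by positivity)
    rw [he]; linarith
  have hc1 : 0 < 1 / (H * (C + 1)) := by positivity
  have hc2 : 0 < 1 / (H * e) * A := by positivity
  refine ⟨min (1 / (H * (C + 1))) (1 / (H * e) * A), lt_min hc1 hc2, fun u hu y hy => ?_⟩
  have hu0 : 0 ≤ u z0 := hu.nonneg z0 hz0
  have hF0 : 0 < F y := hU.pos hy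
  have hFC := (hb (0, y) (subset_closure hy)).2.2
  dsimp only at hFC
  by_cases hFy : q ≤ F y
  · have h1 : u z0 ≤ H * u (0, y) :=
      (hHar u hu (0, y) ⟨by norm_num, subset_closure hy, hFy, by norm_num⟩).2
    calc min (1 / (H * (C + 1))) (1 / (H * e) * A) * u z0 * F y
        ≤ 1 / (H * (C + 1)) * u z0 * (C + 1) := by
          gcongr
          · exact min_le_left _ _
          · linarith
      _ = u z0 / H := by field_simp
      _ ≤ u (0, y) := by rw [div_le_iff₀ hH]; linarith
  push Not at hFy
  have hm0 : 0 ≤ u z0 / (H * e) := by positivity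
  have hmain : ∀ z ∈ collar U F (1 / 2) q,
      u z0 / (H * e) * (Real.exp (A * tilt F (-4 * q) z) - 1) - u z ≤ 0 := by
    have hg := contDiff_exp_tilt (d := d) hU.contDiff A (-4 * q)
    have hsl : ∀ z ∈ collar U F (1 / 2) q, z ∈ slab U := fun z hz =>
      ⟨⟨by linarith [hz.1.1], by linarith [hz.1.2]⟩, hz.2.1⟩
    have hg2 : ContDiff ℝ 2 fun z : Pt d =>
        u z0 / (H * e) * (Real.exp (A * tilt F (-4 * q) z) - 1) :=
      contDiff_const.mul (hg.sub contDiff_const)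
    have hneg : ∀ z : Pt d, tilt F (-4 * q) z ≤ 0 →
        u z0 / (H * e) * (Real.exp (A * tilt F (-4 * q) z) - 1) ≤ 0 := by
      intro z hz
      have h2 : Real.exp (A * tilt F (-4 * q) z) ≤ 1 := Real.exp_le_one_iff.2 (by nlinarith)
      have := mul_nonneg hm0 (sub_nonneg.2 h2)
      linarith
    refine hU.nonpos_of_subharmonic_collar (by norm_num)
      (hg2.continuous.continuousOn.sub hu.continuousOn) ?_ ?_ ?_ ?_
    · exact fun z hz => hg2.contDiffAt.sub (hu.contDiffAt z (hsl z hz))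
    · intro z hz
      have hb1 := hb z (subset_closure hz.2.1)
      have h1 := lap_exp_tilt_nonneg (a := A) (k := -4 * q) hU.contDiff (hb1.1 hz.2.2.le) hb1.2.1
        (by rw [abs_of_pos hA0, hAq, abs_of_neg (by linarith)]; linarith)
      rw [lap_sub hg2.contDiffAt (hu.contDiffAt z (hsl z hz)),
        lap_const_mul (hg.sub contDiff_const).contDiffAt, lap_sub hg.contDiffAt contDiffAt_const,
        lap_const, hu.lap_eq z (hsl z hz)]
      have := mul_nonneg hm0 h1
      linarith
    · intro z hx hy
      rw [hu.eq_zero z ⟨by linarith [hx.1], by linarith [hx.2]⟩ hy]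
      have h1 : tilt F (-4 * q) z ≤ 0 := by
        rw [tilt, lift, hU.eq_zero hy]
        have := mul_nonneg hq.le (sq_nonneg z.1)
        linarith
      have := hneg z h1
      linarith
    · intro z hx hy hF hor
      have hsz : z ∈ slab U := ⟨⟨by linarith [hx.1], by linarith [hx.2]⟩, hy⟩
      have huz := hu.nonneg z hsz
      rcases hor with h | h
      · have := hneg z (by rw [tilt, lift, h]; linarith)
        linarith
      · have hx2 : z.1 ^ 2 ≤ (1 / 2) ^ 2 := sq_le_sq' hx.1 hx.2
        have h1 : u z0 ≤ H * u z := (hHar u hu z ⟨⟨by linarith [hx.1], by linarith [hx.2]⟩,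
          subset_closure hy, h.ge, by linarith⟩).2
        have h2 : tilt F (-4 * q) z ≤ q := by
          rw [tilt, lift, h]
          have := mul_nonneg hq.le (sq_nonneg z.1)
          linarith
        have h3 : Real.exp (A * tilt F (-4 * q) z) ≤ Real.exp (A * q) :=
          Real.exp_le_exp.2 (mul_le_mul_of_nonneg_left h2 hA0.le)
        have h4 : u z0 / (H * e) * (Real.exp (A * tilt F (-4 * q) z) - 1) ≤ u z0 / (H * e) * e := by
          apply mul_le_mul_of_nonneg_left _ hm0
          rw [he]; linarith
        have h5 : u z0 / (H * e) * e = u z0 / H := by field_simp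
        have h6 : u z0 / H ≤ u z := by rw [div_le_iff₀ hH]; linarith
        linarith
  have h1 := hmain (0, y) ⟨by norm_num, hy, hFy⟩
  have h2 : tilt F (-4 * q) (0, y) = F y := by simp [tilt, lift]
  rw [h2] at h1
  have h3 : A * F y ≤ Real.exp (A * F y) - 1 := by
    have := Real.add_one_le_exp (A * F y)
    linarith
  have h4 : u z0 / (H * e) * (A * F y) ≤ u z0 / (H * e) * (Real.exp (A * F y) - 1) :=
    mul_le_mul_of_nonneg_left h3 hm0
  calc min (1 / (H * (C + 1))) (1 / (H * e) * A) * u z0 * F y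
      ≤ 1 / (H * e) * A * u z0 * F y := by
        gcongr
        exact min_le_right _ _
    _ = u z0 / (H * e) * (A * F y) := by ring
    _ ≤ u (0, y) := by linarith

/-- The boundary Harnack inequality on the central cross-section. -/
theorem exists_boundary_harnack : ∃ K : ℝ, 0 < K ∧ ∀ u₁ u₂, IsSlabSolution U u₁ →
    IsSlabSolution U u₂ → ∀ y ∈ U, ∀ y' ∈ U,
      u₁ (0, y) * u₂ (0, y') ≤ K * (u₁ (0, y') * u₂ (0, y)) := by
  obtain ⟨y0, hy0⟩ := hU.isConnected.nonempty
  have hz0 : ((0, y0) : Pt d) ∈ slab U := ⟨by norm_num, hy0⟩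
  obtain ⟨C, hC, hup⟩ := hU.exists_upper_barrier hz0
  obtain ⟨c, hc, hlo⟩ := hU.exists_lower_barrier hz0
  refine ⟨(C / c) ^ 2, by positivity, fun u₁ u₂ h₁ h₂ y hy y' hy' => ?_⟩
  have hF := hU.pos hy
  have hF' := hU.pos hy'
  have p1 := h₁.nonneg _ hz0
  have p2 := h₂.nonneg _ hz0
  have q1 : 0 ≤ u₂ (0, y') := h₂.nonneg _ ⟨by norm_num, hy'⟩
  calc u₁ (0, y) * u₂ (0, y') ≤ (C * u₁ (0, y0) * F y) * (C * u₂ (0, y0) * F y') := by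
        gcongr
        · exact hup u₁ h₁ y hy
        · exact hup u₂ h₂ y' hy'
    _ = (C / c) ^ 2 * ((c * u₁ (0, y0) * F y') * (c * u₂ (0, y0) * F y)) := by field_simp
    _ ≤ (C / c) ^ 2 * (u₁ (0, y') * u₂ (0, y)) := by
        have a := hlo u₁ h₁ y' hy'
        have b := hlo u₂ h₂ y hy
        have := mul_le_mul a b (by positivity) (h₁.nonneg _ ⟨by norm_num, hy'⟩)
        exact mul_le_mul_of_nonneg_left this (by positivity)

end IsSmoothDomain

end BoundaryHarnack

section Decay

variable {d : ℕ} {U : Set (Fin (d+1) → ℝ)} {F : (Fin (d+1) → ℝ) → ℝ} {u : Pt d → ℝ} {η : ℝ}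

lemma sq_fderiv_dirs_le_gradSq (u : Pt d → ℝ) (z : Pt d) (o) :
    (fderiv ℝ u z (dirs o)) ^ 2 ≤ gradSq u z := by
  rw [gradSq_eq_sum]
  exact Finset.single_le_sum (f := fun o => (fderiv ℝ u z (dirs o)) ^ 2)
    (fun _ _ => sq_nonneg _) (Finset.mem_univ o)

lemma abs_le_add_sq_div (hη : 0 < η) {a g : ℝ} (h : a ^ 2 ≤ g) : |a| ≤ η + g / η := by
  have h1 : |a| * η ≤ η ^ 2 + a ^ 2 := by
    have h2 := sq_nonneg (|a| - η)
    have h3 : |a| ^ 2 = a ^ 2 := sq_abs a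
    have h4 := sq_nonneg η
    have h5 := sq_nonneg a
    linarith [show (|a| - η) ^ 2 = |a| ^ 2 - 2 * (|a| * η) + η ^ 2 by ring]
  rw [show η + g / η = (η ^ 2 + g) / η by field_simp, le_div_iff₀ hη]
  linarith

namespace IsSlabSolution

variable (hU : IsSmoothDomain U F) (hu : IsSlabSolution U u)
include hU hu

lemma abs_fderiv_slabTrunc_le (hη : 0 < η) (z : Pt d) (i : Fin (d+1)) :
    |fderiv ℝ (slabTrunc U η u) z (dirs (some i))| ≤
      (slab U).indicator (fun z => η + gradSq u z / η) z := by
  by_cases hz : z ∈ slab U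
  · rw [indicator_of_mem hz]
    have h1 : slabTrunc U η u =ᶠ[nhds z] fun z => ramp η (u z) * cut (3/8) (1 - z.1 ^ 2) :=
      indicator_eventuallyEq_of_isOpen hU.isOpen_slab _ hz
    have hud : DifferentiableAt ℝ u z := (hu.contDiffAt z hz).differentiableAt (by norm_num)
    have hsq : DifferentiableAt ℝ (fun z : Pt d => 1 - z.1 ^ 2) z := by fun_prop
    have hr : DifferentiableAt ℝ (fun z => ramp η (u z)) z :=
      (hasDerivAt_ramp η (u z)).differentiableAt.comp z hud
    have hc : DifferentiableAt ℝ (fun z : Pt d => cut (3/8) (1 - z.1 ^ 2)) z :=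
      DifferentiableAt.comp (g := cut (3/8)) z (hasDerivAt_cut _ _).differentiableAt hsq
    have h2 : fderiv ℝ (slabTrunc U η u) z (dirs (some i)) =
        cut (3/8) (1 - z.1 ^ 2) * (cut η (u z) * fderiv ℝ u z (dirs (some i))) := by
      rw [h1.fderiv_eq, fderiv_mul_apply hr hc,
        fderiv_comp_apply (φ := cut (3/8)) hsq (hasDerivAt_cut _ _),
        fderiv_comp_apply hud (hasDerivAt_ramp _ _), IsSmoothDomain.fderiv_one_sub_sq]
      simp [dirs]
    rw [h2, abs_mul, abs_mul, abs_of_nonneg (cut_nonneg _ _), abs_of_nonneg (cut_nonneg _ _)]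
    have h3 := abs_le_add_sq_div hη (sq_fderiv_dirs_le_gradSq u z (some i))
    refine le_trans ?_ h3
    refine (mul_le_of_le_one_left (mul_nonneg (cut_nonneg _ _) (abs_nonneg _))
      (cut_le_one _ _)).trans (mul_le_of_le_one_left (abs_nonneg _) (cut_le_one _ _))
  · rw [indicator_of_notMem hz]
    have h : slabTrunc U η u =ᶠ[nhds z] fun _ => 0 := by
      filter_upwards [hu.eventually_slabTrunc hU hη hz] with z' h1
      by_cases h2 : z' ∈ slab U
      · rw [slabTrunc, indicator_of_mem h2, h1 h2]
      · rw [slabTrunc, indicator_of_notMem h2]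
    rw [h.fderiv_eq]
    simp

lemma integral_slabTrunc_le (hη : 0 < η) {L : ℝ} (hL0 : 0 ≤ L) (hL : ∀ y ∈ U, |y 0| ≤ L)
    (hE : ∫⁻ z in slab U, ENNReal.ofReal (gradSq u z) ≤ ENNReal.ofReal (η ^ 2)) :
    ∫ z, slabTrunc U η u z ≤ L * ((volume (slab U)).toReal + 1) * η := by
  have hV : volume (slab U) ≠ ⊤ := hU.isBounded_slab.measure_lt_top.ne
  have h1 : ∫ z : Pt d, coord (some 0) z * fderiv ℝ (slabTrunc U η u) z (dirs (some 0))
      = -∫ z, slabTrunc U η u z := by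
    rw [integral_mul_fderiv_eq (coord (some 0)).contDiff
      ((hu.contDiff_slabTrunc hU hη).of_le (by norm_num)) (hasCompactSupport_slabTrunc hU)]
    simp [coord, dirs]
  have h2 : ∀ z : Pt d, |coord (some 0) z * fderiv ℝ (slabTrunc U η u) z (dirs (some 0))| ≤
      (slab U).indicator (fun z => L * (η + gradSq u z / η)) z := by
    intro z
    have h3 := hu.abs_fderiv_slabTrunc_le hU hη z 0
    rw [abs_mul]
    by_cases hz : z ∈ slab U
    · rw [indicator_of_mem hz] at h3 ⊢
      exact mul_le_mul (hL z.2 hz.2) h3 (abs_nonneg _) hL0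
    · rw [indicator_of_notMem hz] at h3 ⊢
      rw [le_antisymm h3 (abs_nonneg _), mul_zero]
  have h4 : ‖∫ z : Pt d, coord (some 0) z * fderiv ℝ (slabTrunc U η u) z (dirs (some 0))‖ₑ ≤
      ENNReal.ofReal (L * ((volume (slab U)).toReal + 1) * η) := by
    calc _ ≤ ∫⁻ z : Pt d, ‖coord (some 0) z * fderiv ℝ (slabTrunc U η u) z (dirs (some 0))‖ₑ :=
          enorm_integral_le_lintegral_enorm _
      _ ≤ ∫⁻ z : Pt d, (slab U).indicator
            (fun z => ENNReal.ofReal (L * (η + gradSq u z / η))) z := by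
          refine lintegral_mono fun z => ?_
          rw [Real.enorm_eq_ofReal_abs]
          refine (ENNReal.ofReal_le_ofReal (h2 z)).trans (le_of_eq ?_)
          by_cases hz : z ∈ slab U
          · simp only [indicator_of_mem hz]
          · simp only [indicator_of_notMem hz, ENNReal.ofReal_zero]
      _ = ∫⁻ z in slab U, (ENNReal.ofReal (L * η) +
            ENNReal.ofReal (L / η) * ENNReal.ofReal (gradSq u z)) := by
          rw [lintegral_indicator hU.isOpen_slab.measurableSet]
          refine lintegral_congr fun z => ?_
          rw [← ENNReal.ofReal_mul (by positivity), ← ENNReal.ofReal_add (by positivity)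
            (mul_nonneg (by positivity) (gradSq_nonneg _ _))]
          congr 1; ring
      _ = ENNReal.ofReal (L * η) * volume (slab U) +
            ENNReal.ofReal (L / η) * ∫⁻ z in slab U, ENNReal.ofReal (gradSq u z) := by
          rw [lintegral_add_left measurable_const, setLIntegral_const,
            lintegral_const_mul' _ _ ENNReal.ofReal_ne_top]
      _ ≤ ENNReal.ofReal (L * η) * ENNReal.ofReal ((volume (slab U)).toReal) +
            ENNReal.ofReal (L / η) * ENNReal.ofReal (η ^ 2) := by
          rw [ENNReal.ofReal_toReal hV]
          gcongr
      _ = _ := by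
          rw [← ENNReal.ofReal_mul (by positivity), ← ENNReal.ofReal_mul (by positivity),
            ← ENNReal.ofReal_add (by positivity) (by positivity)]
          congr 1; field_simp
  rw [h1, enorm_neg, Real.enorm_eq_ofReal_abs, ENNReal.ofReal_le_ofReal_iff (by positivity)] at h4
  exact (le_abs_self _).trans h4

end IsSlabSolution

namespace IsSmoothDomain

variable (hU : IsSmoothDomain U F)
include hU

/-- A slab solution with small energy is small on the central cross-section. -/
theorem exists_energy_bound : ∃ B : ℝ, 0 < B ∧ ∀ u, IsSlabSolution U u → ∀ η > 0,
    ∫⁻ z in slab U, ENNReal.ofReal (gradSq u z) ≤ ENNReal.ofReal (η ^ 2) →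
      ∀ y ∈ U, u (0, y) ≤ B * η := by
  obtain ⟨L, hL⟩ := hU.isBounded.exists_norm_le
  have hk : 0 < ∫ y : Pt d, kern y := integral_kern_pos
  set L' := max L 0 with hL'
  have hL0 : 0 ≤ L' := le_max_right _ _
  set V := (volume (slab U)).toReal
  have hV : 0 ≤ V := ENNReal.toReal_nonneg
  refine ⟨4 ^ Module.finrank ℝ (Pt d) * (L' * (V + 1)) / (∫ y : Pt d, kern y) + 2, by positivity,
    fun u hu η hη hE y hy => ?_⟩
  have h0y : ((0, y) : Pt d) ∈ slab U := ⟨by norm_num, hy⟩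
  have h1 := hu.slabTrunc_mul_integral_kern_le hU hη (z := (0, y)) (by norm_num)
  rw [IsSlabSolution.slabTrunc_eq h0y (by norm_num)] at h1
  have h2 := sub_le_ramp hη (u (0, y))
  have h3 := hu.integral_slabTrunc_le hU hη hL0
    (fun y hy => (norm_le_pi_norm y 0).trans ((hL y hy).trans (le_max_left _ _))) hE
  have h4 : ∫ x, slabTrunc U η u x * kern ((4 : ℝ) • (x - (0, y))) ≤ ∫ x, slabTrunc U η u x := by
    refine integral_mono_of_nonneg (Eventually.of_forall fun x => mul_nonneg
      (IsSlabSolution.slabTrunc_nonneg hη x) (kern_nonneg _)) ?_ (Eventually.of_forall fun x =>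
      mul_le_of_le_one_right (IsSlabSolution.slabTrunc_nonneg hη x) (kern_le_one _))
    exact (hu.contDiff_slabTrunc hU hη).continuous.integrable_of_hasCompactSupport
      (IsSlabSolution.hasCompactSupport_slabTrunc hU)
  have h5 : ramp η (u (0, y)) ≤
      4 ^ Module.finrank ℝ (Pt d) * (L' * (V + 1)) / (∫ y : Pt d, kern y) * η := by
    rw [div_mul_eq_mul_div, le_div_iff₀ hk, mul_assoc]
    exact h1.trans (by gcongr; exact h4.trans h3)
  rw [add_mul]
  linarith

end IsSmoothDomain

end Decay

section Waveguide

variable {d : ℕ} {U UL UR : Set (Fin (d+1) → ℝ)} {F FL FR : (Fin (d+1) → ℝ) → ℝ} {u v w : Pt d → ℝ}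

lemma HasSmoothBoundary.exists_isSmoothDomain (hs : HasSmoothBoundary U)
    (hb : Bornology.IsBounded U) (hc : IsConnected U) : ∃ F, IsSmoothDomain U F := by
  obtain ⟨f, hf, hUf, hd⟩ := hs
  refine ⟨fun y => -f y, hb, hc, (contDiff_infty.1 hf 2).neg, by simp [hUf], ?_⟩
  intro y hy h
  rw [fderiv_fun_neg, neg_eq_zero] at h
  exact hd y hy h

lemma isOpen_OmegaSet (hL : IsOpen UL) (hR : IsOpen UR) : IsOpen (OmegaSet UL UR) := by
  have : OmegaSet UL UR = {z | z.1 < 0 ∧ z.2 ∈ UL} ∪ {z | 0 < z.1 ∧ z.2 ∈ UR} ∪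
      {z | z.2 ∈ UL ∩ UR} := by
    ext z
    simp only [OmegaSet, mem_ofPred_eq, mem_union, mem_inter_iff]
    rcases lt_trichotomy z.1 0 with h | h | h
    · simp [h, h.not_gt, h.ne]; tauto
    · simp [h]
    · simp [h, h.not_gt, h.ne']
  rw [this]
  refine IsOpen.union (IsOpen.union ?_ ?_) ?_
  · exact (isOpen_lt continuous_fst continuous_const).inter (hL.preimage continuous_snd)
  · exact (isOpen_lt continuous_const continuous_fst).inter (hR.preimage continuous_snd)
  · exact (hL.inter hR).preimage continuous_snd

lemma mk_mem_OmegaSet_right {T : ℝ} (hT : 0 < T) {y} (hy : y ∈ UR) :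
    ((T, y) : Pt d) ∈ OmegaSet UL UR := Or.inr (Or.inl ⟨hT, hy⟩)

lemma mk_mem_OmegaSet_left {T : ℝ} (hT : 0 < T) {y} (hy : y ∈ UL) :
    ((-T, y) : Pt d) ∈ OmegaSet UL UR := Or.inl ⟨neg_neg_of_pos hT, hy⟩

lemma snd_mem_right_of_mem_OmegaSet {z : Pt d} (hz : z ∈ OmegaSet UL UR) (h : 0 ≤ z.1) :
    z.2 ∈ UR := by
  rcases hz with h1 | h1 | h1
  · exact absurd h1.1 (not_lt.2 h)
  · exact h1.2
  · exact h1.2.2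

lemma snd_mem_left_of_mem_OmegaSet {z : Pt d} (hz : z ∈ OmegaSet UL UR) (h : z.1 ≤ 0) :
    z.2 ∈ UL := by
  rcases hz with h1 | h1 | h1
  · exact h1.2
  · exact absurd h1.1 (not_lt.2 h)
  · exact h1.2.1

lemma mem_closure_OmegaSet_right {z : Pt d} (h : 0 ≤ z.1) (hz : z.2 ∈ closure UR) :
    z ∈ closure (OmegaSet UL UR) := by
  have h1 : z ∈ closure (Ioi (0 : ℝ) ×ˢ UR) := by
    rw [closure_prod_eq, closure_Ioi]
    exact ⟨h, hz⟩
  exact closure_mono (fun z hz => Or.inr (Or.inl hz)) h1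

lemma preimage_mirror_OmegaSet : mirror d ⁻¹' OmegaSet UL UR = OmegaSet UR UL := by
  ext z
  simp only [OmegaSet, mem_preimage, mirror_apply, mem_ofPred_eq, mem_inter_iff, neg_lt_zero,
    Left.neg_pos_iff, neg_eq_zero]
  tauto

namespace IsSolution

lemma contDiffAt (hL : IsOpen UL) (hR : IsOpen UR) (hu : IsSolution UL UR u) {z : Pt d}
    (hz : z ∈ OmegaSet UL UR) : ContDiffAt ℝ 2 u z :=
  hu.2.2.1.contDiffAt ((isOpen_OmegaSet hL hR).mem_nhds hz)

lemma const_mul (hL : IsOpen UL) (hR : IsOpen UR) (hu : IsSolution UL UR u) (c : ℝ) :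
    IsSolution UL UR fun z => c * u z := by
  refine ⟨continuousOn_const.mul hu.1, contDiffOn_const.mul hu.2.1, contDiffOn_const.mul hu.2.2.1,
    fun z hz => ?_, fun z hz => ?_⟩
  · rw [lap_const_mul (hu.contDiffAt hL hR hz), hu.2.2.2.1 z hz, mul_zero]
  · beta_reduce
    rw [hu.2.2.2.2 z hz, mul_zero]

lemma sub (hL : IsOpen UL) (hR : IsOpen UR) (hu : IsSolution UL UR u) (hv : IsSolution UL UR v) :
    IsSolution UL UR fun z => u z - v z := by
  refine ⟨hu.1.sub hv.1, hu.2.1.sub hv.2.1, hu.2.2.1.sub hv.2.2.1, fun z hz => ?_, fun z hz => ?_⟩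
  · rw [lap_sub (hu.contDiffAt hL hR hz) (hv.contDiffAt hL hR hz), hu.2.2.2.1 z hz,
      hv.2.2.2.1 z hz, sub_zero]
  · beta_reduce
    rw [hu.2.2.2.2 z hz, hv.2.2.2.2 z hz, sub_zero]

lemma comp_mirror (hu : IsSolution UL UR u) : IsSolution UR UL fun z => u (mirror d z) := by
  have hm : MapsTo (mirror d) (OmegaSet UR UL) (OmegaSet UL UR) := by
    rw [← preimage_mirror_OmegaSet]; exact mapsTo_preimage _ _
  have hc : mirror d ⁻¹' closure (OmegaSet UL UR) = closure (OmegaSet UR UL) := by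
    rw [← preimage_mirror_OmegaSet (UL := UL)]
    exact (mirror d).toHomeomorph.preimage_closure _
  have hf : mirror d ⁻¹' frontier (OmegaSet UL UR) = frontier (OmegaSet UR UL) := by
    rw [← preimage_mirror_OmegaSet (UL := UL)]
    exact (mirror d).toHomeomorph.preimage_frontier _
  refine ⟨hu.1.comp (mirror d).continuous.continuousOn (by rw [← hc]; exact mapsTo_preimage _ _),
    hu.2.1.comp (mirror d).contDiff.contDiffOn hm, hu.2.2.1.comp (mirror d).contDiff.contDiffOn hm,
    fun z hz => ?_, fun z hz => ?_⟩
  · rw [lap_comp_mirror, hu.2.2.2.1 _ (hm hz)]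
  · rw [← hf] at hz
    exact hu.2.2.2.2 _ hz

lemma isSlabSolution (hL : IsOpen UL) (hR : IsOpen UR) (hu : IsSolution UL UR u)
    (hpos : ∀ z ∈ OmegaSet UL UR, 0 ≤ u z) {T : ℝ} (hT : 1 ≤ T) :
    IsSlabSolution UR fun z => u (z + (T, 0)) := by
  have hm : ∀ z ∈ slab UR, z + (T, 0) ∈ OmegaSet UL UR := fun z hz =>
    Or.inr (Or.inl ⟨by simp only [Prod.fst_add]; linarith [hz.1.1],
      by simp only [Prod.snd_add, add_zero]; exact hz.2⟩)
  have hcl : ∀ z : Pt d, z.1 ∈ Icc (-1 : ℝ) 1 → z.2 ∈ closure UR →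
      z + (T, 0) ∈ closure (OmegaSet UL UR) := fun z h1 h2 =>
    mem_closure_OmegaSet_right (by simp only [Prod.fst_add]; linarith [h1.1])
      (by simp only [Prod.snd_add, add_zero]; exact h2)
  refine ⟨fun z hz => hpos _ (hm z hz), fun z hz => ?_, fun z hz => ?_, ?_, fun z h1 h2 => ?_⟩
  · exact (hu.contDiffAt hL hR (hm z hz)).comp z (contDiffAt_id.add contDiffAt_const)
  · rw [lap_comp_add, hu.2.2.2.1 _ (hm z hz)]
  · exact hu.1.comp (by fun_prop) fun z hz => hcl z hz.1 hz.2
  · refine hu.2.2.2.2 _ ?_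
    rw [(isOpen_OmegaSet hL hR).frontier_eq]
    refine ⟨hcl z h1 h2.1, fun h => ?_⟩
    have h3 := snd_mem_right_of_mem_OmegaSet h (by simp only [Prod.fst_add]; linarith [h1.1])
    simp only [Prod.snd_add, add_zero] at h3
    rw [hR.frontier_eq] at h2
    exact h2.2 h3

/-- The maximum principle in the part of `Ω` between two cross-sections. -/
lemma le_of_le_slices (hL : IsOpen UL) (hR : IsOpen UR) (hLb : Bornology.IsBounded UL)
    (hRb : Bornology.IsBounded UR) (hu : IsSolution UL UR u) {δ S T : ℝ} (hδ : 0 ≤ δ) (hS : 0 < S)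
    (hT : 0 < T) (hright : ∀ y ∈ UR, u (T, y) ≤ δ) (hleft : ∀ y ∈ UL, u (-S, y) ≤ δ) :
    ∀ z ∈ OmegaSet UL UR, -S < z.1 → z.1 < T → u z ≤ δ := by
  set D : Set (Pt d) := OmegaSet UL UR ∩ {z | z.1 ∈ Ioo (-S) T} with hD
  have hDo : IsOpen D := (isOpen_OmegaSet hL hR).inter (isOpen_Ioo.preimage continuous_fst)
  have hDb : Bornology.IsBounded D := by
    refine ((Metric.isBounded_Ioo (-S) T).prod (hLb.union hRb)).subset fun z hz => ⟨hz.2, ?_⟩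
    rcases le_total z.1 0 with h | h
    · exact Or.inl (snd_mem_left_of_mem_OmegaSet hz.1 h)
    · exact Or.inr (snd_mem_right_of_mem_OmegaSet hz.1 h)
  have hcl : closure D ⊆ closure (OmegaSet UL UR) := closure_mono inter_subset_left
  have hcl2 : closure D ⊆ {z | z.1 ∈ Icc (-S) T} :=
    closure_minimal (fun z hz => Ioo_subset_Icc_self hz.2) (isClosed_Icc.preimage continuous_fst)
  have key : ∀ z ∈ D, u z - δ ≤ 0 := by
    refine nonpos_of_subharmonic hDo hDb ((hu.1.mono hcl).sub continuousOn_const)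
      (fun z hz => (hu.contDiffAt hL hR hz.1).sub contDiffAt_const) (fun z hz => ?_) fun z hz => ?_
    · rw [lap_sub (hu.contDiffAt hL hR hz.1) contDiffAt_const, hu.2.2.2.1 z hz.1, lap_const,
        sub_zero]
    · rw [hDo.frontier_eq] at hz
      by_cases hzO : z ∈ OmegaSet UL UR
      · have h1 := hcl2 hz.1
        have h2 : z.1 = -S ∨ z.1 = T := by
          by_contra! hne
          exact hz.2 ⟨hzO, lt_of_le_of_ne h1.1 hne.1.symm, lt_of_le_of_ne h1.2 hne.2⟩
        rcases h2 with h2 | h2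
        · have h3 := hleft z.2 (snd_mem_left_of_mem_OmegaSet hzO (by linarith))
          rw [← h2] at h3
          exact sub_nonpos.2 h3
        · have h3 := hright z.2 (snd_mem_right_of_mem_OmegaSet hzO (by linarith))
          rw [← h2] at h3
          exact sub_nonpos.2 h3
      · rw [hu.2.2.2.2 z (by rw [(isOpen_OmegaSet hL hR).frontier_eq]; exact ⟨hcl hz.1, hzO⟩)]
        linarith
  exact fun z hz h1 h2 => sub_nonpos.1 (key z ⟨hz, h1, h2⟩)

/-- A nonnegative solution with finite energy in the right chamber decays there. -/
theorem decay_right (hUR : IsSmoothDomain UR FR) (hL : IsOpen UL) (hu : IsSolution UL UR u)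
    (hpos : ∀ z ∈ OmegaSet UL UR, 0 ≤ u z)
    (hE : (∫⁻ z in CRset UR, ENNReal.ofReal (gradSq u z)) < ⊤) {ε : ℝ} (hε : 0 < ε) :
    ∃ R : ℝ, ∀ T ≥ R, ∀ y ∈ UR, u (T, y) ≤ ε := by
  obtain ⟨B, hB, hbound⟩ := hUR.exists_energy_bound
  set g : Pt d → ENNReal := fun z => ENNReal.ofReal (gradSq u z) with hg
  set ν := (volume.restrict (CRset UR)).withDensity g with hν
  have hCR : MeasurableSet (CRset UR) :=
    ((isOpen_lt continuous_const continuous_fst).inter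
      (hUR.isOpen.preimage continuous_snd)).measurableSet
  have hs : ∀ t : ℝ, MeasurableSet {z : Pt d | t ≤ z.1} := fun t =>
    (isClosed_le continuous_const continuous_fst).measurableSet
  have hνs : ∀ t : ℝ, ν {z : Pt d | t ≤ z.1} = ∫⁻ z in {z | t ≤ z.1} ∩ CRset UR, g z := by
    intro t
    rw [hν, withDensity_apply _ (hs t), Measure.restrict_restrict (hs t)]
  have htend : Tendsto (fun t : ℝ => ν {z : Pt d | t ≤ z.1}) atTop (nhds 0) := by
    have h1 := tendsto_measure_iInter_atTop (μ := ν) (s := fun t : ℝ => {z : Pt d | t ≤ z.1})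
      (fun t => (hs t).nullMeasurableSet) (fun a b hab z hz => le_trans hab hz)
      ⟨0, by rw [hνs]; exact ((lintegral_mono_set inter_subset_right).trans_lt hE).ne⟩
    have h2 : ⋂ t : ℝ, {z : Pt d | t ≤ z.1} = ∅ := by
      refine eq_empty_of_forall_notMem fun z hz => ?_
      have := mem_iInter.1 hz (z.1 + 1)
      rw [mem_ofPred_eq] at this
      linarith
    rw [h2, measure_empty] at h1
    exact h1
  set η := ε / B with hη_def
  have hη : 0 < η := by positivity
  obtain ⟨R, hR⟩ := eventually_atTop.1 (htend.eventually_lt_const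
    (show (0 : ENNReal) < ENNReal.ofReal (η ^ 2) from ENNReal.ofReal_pos.2 (by positivity)))
  refine ⟨max R 0 + 1, fun T hT y hy => ?_⟩
  have hT1 : 1 ≤ T := by linarith [le_max_right R 0]
  have hTR : R ≤ T - 1 := by linarith [le_max_left R 0]
  have h1 := hbound _ (hu.isSlabSolution hL hUR.isOpen hpos hT1) η hη ?_ y hy
  · rw [hη_def, mul_div_cancel₀ _ hB.ne'] at h1
    simpa using h1
  · simp only [gradSq_comp_add]
    calc ∫⁻ z in slab UR, g (z + (T, 0))
        = ∫⁻ z, (slab UR).indicator (fun z => g (z + (T, 0))) z :=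
          (lintegral_indicator hUR.isOpen_slab.measurableSet _).symm
      _ ≤ ∫⁻ z, ({z | T - 1 ≤ z.1} ∩ CRset UR).indicator g (z + (T, 0)) := by
          refine lintegral_mono fun z => ?_
          by_cases hz : z ∈ slab UR
          · rw [indicator_of_mem hz, indicator_of_mem]
            exact ⟨by simp only [mem_ofPred_eq, Prod.fst_add]; linarith [hz.1.1],
              by simp only [Prod.fst_add]; linarith [hz.1.1],
              by simp only [Prod.snd_add, add_zero]; exact hz.2⟩
          · rw [indicator_of_notMem hz]
            exact zero_le
      _ = ∫⁻ z in {z | T - 1 ≤ z.1} ∩ CRset UR, g z := by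
          rw [lintegral_add_right_eq_self, lintegral_indicator ((hs _).inter hCR)]
      _ ≤ ENNReal.ofReal (η ^ 2) := by
          rw [← hνs]
          exact (hR _ hTR).le

end IsSolution

lemma setLIntegral_CRset_comp_mirror (u : Pt d → ℝ) (U : Set (Fin (d+1) → ℝ)) :
    ∫⁻ z in CRset U, ENNReal.ofReal (gradSq (fun z => u (mirror d z)) z) =
      ∫⁻ z in CLset U, ENNReal.ofReal (gradSq u z) := by
  have hmp : MeasurePreserving (mirror d) volume volume :=
    (Measure.measurePreserving_neg (volume : Measure ℝ)).prod
      (MeasurePreserving.id (volume : Measure (Fin (d+1) → ℝ)))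
  have hpre : mirror d ⁻¹' CLset U = CRset U := by
    ext z; simp [CLset, CRset]
  simp only [gradSq_comp_mirror]
  rw [← hpre]
  exact hmp.setLIntegral_comp_preimage_emb (mirror d).toHomeomorph.measurableEmbedding
    (fun z => ENNReal.ofReal (gradSq u z)) _

end Waveguide

section Coefficients

variable {d : ℕ} {UL UR : Set (Fin (d+1) → ℝ)} {F : (Fin (d+1) → ℝ) → ℝ} {v w : Pt d → ℝ}

/-- Domination on all far right cross-sections propagates to `Ω` when `v` decays on the left. -/
lemma mul_le_of_eventually_slices (hL : IsOpen UL) (hR : IsOpen UR)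
    (hLb : Bornology.IsBounded UL) (hRb : Bornology.IsBounded UR)
    (hv : IsSolution UL UR v) (hw : IsSolution UL UR w) (hwpos : ∀ z ∈ OmegaSet UL UR, 0 ≤ w z)
    (hdecay : ∀ ε > 0, ∃ R : ℝ, ∀ T ≥ R, ∀ y ∈ UL, v (-T, y) ≤ ε) {c R : ℝ} (hc : 0 ≤ c)
    (h : ∀ T ≥ R, ∀ y ∈ UR, c * v (T, y) ≤ w (T, y)) :
    ∀ z ∈ OmegaSet UL UR, c * v z ≤ w z := by
  intro z hz
  refine le_of_forall_pos_le_add fun δ hδ => ?_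
  obtain ⟨R', hR'⟩ := hdecay (δ / (c + 1)) (by positivity)
  set S := max R' (|z.1| + 1) with hS
  set T := max R (|z.1| + 1) with hT
  have hS1 : |z.1| + 1 ≤ S := le_max_right _ _
  have hT1 : |z.1| + 1 ≤ T := le_max_right _ _
  have h0 := abs_nonneg z.1
  have hS0 : 0 < S := by linarith
  have hT0 : 0 < T := by linarith
  have key := ((hv.const_mul hL hR c).sub hL hR hw).le_of_le_slices hL hR hLb hRb hδ.le
    hS0 hT0 (fun y hy => ?_) (fun y hy => ?_) z hz
    (by linarith [neg_abs_le z.1]) (by linarith [le_abs_self z.1])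
  · linarith
  · have := h T (le_max_left _ _) y hy
    linarith
  · have h1 := hR' S (le_max_left _ _) y hy
    have h2 := hwpos _ (mk_mem_OmegaSet_left (UR := UR) hS0 hy)
    have h3 : c * v (-S, y) ≤ δ := by
      calc c * v (-S, y) ≤ c * (δ / (c + 1)) := mul_le_mul_of_nonneg_left h1 hc
        _ = c / (c + 1) * δ := by ring
        _ ≤ 1 * δ := by
          gcongr
          rw [div_le_one (by positivity)]
          linarith
        _ = δ := one_mul δ
    linarith

/-- A positive solution is asymptotically proportional, along a sequence of cross-sections on the
right, to any positive solution which decays on the left. -/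
theorem exists_coeff_right (hL : IsOpen UL) (hLb : Bornology.IsBounded UL)
    (hUR : IsSmoothDomain UR F)
    (hv : IsSolution UL UR v) (hvpos : ∀ z ∈ OmegaSet UL UR, 0 < v z)
    (hw : IsSolution UL UR w) (hwpos : ∀ z ∈ OmegaSet UL UR, 0 < w z)
    (hdecay : ∀ ε > 0, ∃ R : ℝ, ∀ T ≥ R, ∀ y ∈ UL, v (-T, y) ≤ ε) :
    ∃ c : ℝ, 0 ≤ c ∧ ∀ ε > 0, ∀ X : ℝ, ∃ T ≥ X, ∀ y ∈ UR,
      |w (T, y) - c * v (T, y)| ≤ ε * v (T, y) := by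
  have hR := hUR.isOpen
  obtain ⟨y0, hy0⟩ := hUR.isConnected.nonempty
  obtain ⟨K, hK, hharnack⟩ := hUR.exists_boundary_harnack
  set A : Set ℝ := {c | 0 ≤ c ∧ ∃ R : ℝ, ∀ T ≥ R, ∀ y ∈ UR, c * v (T, y) ≤ w (T, y)} with hA
  have hglob : ∀ c ∈ A, ∀ z ∈ OmegaSet UL UR, c * v z ≤ w z := fun c hc => by
    obtain ⟨hc0, R, hcR⟩ := hc
    exact mul_le_of_eventually_slices hL hR hLb hUR.isBounded hv hw (fun z hz => (hwpos z hz).le)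
      hdecay hc0 hcR
  have h0 : (0 : ℝ) ∈ A := ⟨le_rfl, 1, fun T hT y hy => by
    rw [zero_mul]
    exact (hwpos _ (mk_mem_OmegaSet_right (by linarith) hy)).le⟩
  have hbdd : BddAbove A := by
    have hz := mk_mem_OmegaSet_right (UL := UL) one_pos hy0
    exact ⟨w (1, y0) / v (1, y0), fun c hc => (le_div_iff₀ (hvpos _ hz)).2 (hglob c hc _ hz)⟩
  set m := sSup A with hm
  have hm0 : 0 ≤ m := le_csSup hbdd h0
  refine ⟨m, hm0, fun ε hε X => ?_⟩
  set η := ε / (2 * K + 1) with hη_def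
  have hη : 0 < η := by positivity
  obtain ⟨c, hcA, hcm⟩ := exists_lt_of_lt_csSup ⟨0, h0⟩ (show m - η < m by linarith)
  have hcm' : c ≤ m := le_csSup hbdd hcA
  have hnot : m + η ∉ A := fun h => by linarith [le_csSup hbdd h]
  have hex : ∃ T ≥ max X 1, ∃ y ∈ UR, w (T, y) < (m + η) * v (T, y) := by
    by_contra! hcon
    exact hnot ⟨by linarith, max X 1, hcon⟩
  obtain ⟨T, hT, y', hy', hlt⟩ := hex
  have hT1 : 1 ≤ T := (le_max_right _ _).trans hT
  refine ⟨T, (le_max_left _ _).trans hT, fun y hy => ?_⟩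
  have hs1 := (hw.sub hL hR (hv.const_mul hL hR c)).isSlabSolution hL hR
    (fun z hz => sub_nonneg.2 (hglob c hcA z hz)) hT1
  have hs2 := hv.isSlabSolution hL hR (fun z hz => (hvpos z hz).le) hT1
  have hBH := hharnack _ _ hs1 hs2 y hy y' hy'
  simp only [Prod.mk_add_mk, zero_add, add_zero] at hBH
  have hmy := mk_mem_OmegaSet_right (UL := UL) (zero_lt_one.trans_le hT1) hy
  have hmy' := mk_mem_OmegaSet_right (UL := UL) (zero_lt_one.trans_le hT1) hy'
  have hvy := hvpos _ hmy
  have hvy' := hvpos _ hmy'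
  have h1 : w (T, y') - c * v (T, y') ≤ 2 * η * v (T, y') := by
    have : (m + η) * v (T, y') ≤ (c + 2 * η) * v (T, y') :=
      mul_le_mul_of_nonneg_right (by linarith) hvy'.le
    linarith
  have h2 : w (T, y) - c * v (T, y) ≤ K * (2 * η * v (T, y)) := by
    refine le_of_mul_le_mul_right ?_ hvy'
    calc (w (T, y) - c * v (T, y)) * v (T, y')
        ≤ K * ((w (T, y') - c * v (T, y')) * v (T, y)) := hBH
      _ ≤ K * ((2 * η * v (T, y')) * v (T, y)) := by gcongr
      _ = K * (2 * η * v (T, y)) * v (T, y') := by ring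
  have h3 : 0 ≤ w (T, y) - c * v (T, y) := sub_nonneg.2 (hglob c hcA _ hmy)
  have h4 : (m - c) * v (T, y) ≤ η * v (T, y) :=
    mul_le_mul_of_nonneg_right (by linarith) hvy.le
  have h5 : 0 ≤ (m - c) * v (T, y) := mul_nonneg (by linarith) hvy.le
  have h6 : ε * v (T, y) = K * (2 * η * v (T, y)) + η * v (T, y) := by
    rw [hη_def]; field_simp
  have h7 : 0 ≤ K * (2 * η * v (T, y)) := by positivity
  rw [h6, abs_le]
  constructor <;> linarith [mul_pos hη hvy]

end Coefficients

/-- If `v^L` and `v^R` are positive solutions on `Ω` with finite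
Dirichlet energy on `C^L` and `C^R` respectively, then every positive solution on `Ω` is a
combination `c^L v^L + c^R v^R` with `c^L, c^R ≥ 0` not both zero. -/
theorem statement18 {d : ℕ} (UL UR : Set (Fin (d+1) → ℝ))
    (hULo : IsOpen UL) (hULb : Bornology.IsBounded UL) (hULc : IsConnected UL)
    (hULs : HasSmoothBoundary UL)
    (hURo : IsOpen UR) (hURb : Bornology.IsBounded UR) (hURc : IsConnected UR)
    (hURs : HasSmoothBoundary UR)
    (hcap : (UL ∩ UR).Nonempty)
    (vL vR : ℝ × (Fin (d+1) → ℝ) → ℝ)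
    (hvL : IsSolution UL UR vL) (hvLpos : ∀ z ∈ OmegaSet UL UR, 0 < vL z)
    (hvLenergy : (∫⁻ z in CLset UL, ENNReal.ofReal (gradSq vL z)) < ⊤)
    (hvR : IsSolution UL UR vR) (hvRpos : ∀ z ∈ OmegaSet UL UR, 0 < vR z)
    (hvRenergy : (∫⁻ z in CRset UR, ENNReal.ofReal (gradSq vR z)) < ⊤)
    (w : ℝ × (Fin (d+1) → ℝ) → ℝ)
    (hw : IsSolution UL UR w) (hwpos : ∀ z ∈ OmegaSet UL UR, 0 < w z) :
    ∃ cL cR : ℝ, 0 ≤ cL ∧ 0 ≤ cR ∧ (cL ≠ 0 ∨ cR ≠ 0) ∧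
      ∀ z ∈ OmegaSet UL UR, w z = cL * vL z + cR * vR z := by
  obtain ⟨FL, hFL⟩ := hULs.exists_isSmoothDomain hULb hULc
  obtain ⟨FR, hFR⟩ := hURs.exists_isSmoothDomain hURb hURc
  have hmir : ∀ u : Pt d → ℝ, (∀ z ∈ OmegaSet UL UR, 0 < u z) →
      ∀ z ∈ OmegaSet UR UL, 0 < u (mirror d z) := fun u hu z hz => by
    rw [← preimage_mirror_OmegaSet] at hz
    exact hu _ hz
  have hdR : ∀ ε > 0, ∃ R : ℝ, ∀ T ≥ R, ∀ y ∈ UR, vR (T, y) ≤ ε := fun ε hε =>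
    hvR.decay_right hFR hULo (fun z hz => (hvRpos z hz).le) hvRenergy hε
  have hdL : ∀ ε > 0, ∃ R : ℝ, ∀ T ≥ R, ∀ y ∈ UL, vL (-T, y) ≤ ε := fun ε hε =>
    hvL.comp_mirror.decay_right hFL hURo (fun z hz => (hmir vL hvLpos z hz).le)
      (by rwa [setLIntegral_CRset_comp_mirror]) hε
  obtain ⟨cL, hcL, hright⟩ := exists_coeff_right hULo hULb hFR hvL hvLpos hw hwpos hdL
  obtain ⟨cR, hcR, hleft⟩ := exists_coeff_right hURo hURb hFL hvR.comp_mirror (hmir vR hvRpos)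
    hw.comp_mirror (hmir w hwpos) (fun ε hε => by simpa using hdR ε hε)
  simp only [mirror_apply] at hleft
  have habs : ∀ ε > 0, ∀ z ∈ OmegaSet UL UR,
      |w z - cL * vL z - cR * vR z| ≤ ε * (vL z + vR z + (cL + cR)) := by
    intro ε hε z hz
    obtain ⟨RR, hRR⟩ := hdR ε hε
    obtain ⟨RL, hRL⟩ := hdL ε hε
    obtain ⟨T, hT, hTb⟩ := hright ε hε (max RR (|z.1| + 1))
    obtain ⟨S, hS, hSb⟩ := hleft ε hε (max RL (|z.1| + 1))
    have hT1 : |z.1| + 1 ≤ T := (le_max_right _ _).trans hT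
    have hS1 : |z.1| + 1 ≤ S := (le_max_right _ _).trans hS
    have hz0 := abs_nonneg z.1
    have hT0 : 0 < T := by linarith
    have hS0 : 0 < S := by linarith
    have hr : ∀ y ∈ UR, |w (T, y) - cL * vL (T, y) - cR * vR (T, y)| ≤
        ε * vL (T, y) + ε * vR (T, y) + ε * (cL + cR) := fun y hy => by
      have hmem := mk_mem_OmegaSet_right (UL := UL) hT0 hy
      have h1 := abs_le.1 (hTb y hy)
      have h2 := mul_le_mul_of_nonneg_left (hRR T ((le_max_left _ _).trans hT) y hy) hcR
      have h3 := mul_nonneg hcR (hvRpos _ hmem).le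
      have h4 := mul_pos hε (hvRpos _ hmem)
      have h5 := mul_nonneg hε.le hcL
      rw [abs_le]
      constructor <;> linarith
    have hl : ∀ y ∈ UL, |w (-S, y) - cL * vL (-S, y) - cR * vR (-S, y)| ≤
        ε * vL (-S, y) + ε * vR (-S, y) + ε * (cL + cR) := fun y hy => by
      have hmem := mk_mem_OmegaSet_left (UR := UR) hS0 hy
      have h1 := abs_le.1 (hSb y hy)
      have h2 := mul_le_mul_of_nonneg_left (hRL S ((le_max_left _ _).trans hS) y hy) hcL
      have h3 := mul_nonneg hcL (hvLpos _ hmem).le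
      have h4 := mul_pos hε (hvLpos _ hmem)
      have h5 := mul_nonneg hε.le hcR
      rw [abs_le]
      constructor <;> linarith
    have hh := (hw.sub hULo hURo (hvL.const_mul hULo hURo cL)).sub hULo hURo
      (hvR.const_mul hULo hURo cR)
    have hbound : ∀ σ : ℝ, |σ| = 1 →
        σ * (w z - cL * vL z - cR * vR z) - ε * vL z - ε * vR z ≤ ε * (cL + cR) := by
      intro σ hσ
      have hσ' : ∀ t : ℝ, σ * t ≤ |t| := fun t => by
        have := le_abs_self (σ * t)
        rwa [abs_mul, hσ, one_mul] at this
      refine (((hh.const_mul hULo hURo σ).sub hULo hURo (hvL.const_mul hULo hURo ε)).sub hULo hURo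
        (hvR.const_mul hULo hURo ε)).le_of_le_slices hULo hURo hULb hURb (by positivity) hS0 hT0
        (fun y hy => ?_) (fun y hy => ?_) z hz (by linarith [neg_abs_le z.1])
        (by linarith [le_abs_self z.1])
      · linarith [(hσ' _).trans (hr y hy)]
      · linarith [(hσ' _).trans (hl y hy)]
    have hp := hbound 1 abs_one
    have hn := hbound (-1) (by simp)
    rw [abs_le]
    constructor <;> linarith
  have heq : ∀ z ∈ OmegaSet UL UR, w z = cL * vL z + cR * vR z := by
    intro z hz
    have hM : 0 < vL z + vR z + (cL + cR) := by linarith [hvLpos z hz, hvRpos z hz]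
    have h0 : |w z - cL * vL z - cR * vR z| ≤ 0 := by
      refine le_of_forall_pos_le_add fun δ hδ => ?_
      have := habs (δ / (vL z + vR z + (cL + cR))) (by positivity) z hz
      rwa [div_mul_cancel₀ _ hM.ne', ← zero_add δ] at this
    linarith [abs_nonpos_iff.1 h0]
  refine ⟨cL, cR, hcL, hcR, ?_, heq⟩
  by_contra! hcon
  obtain ⟨y, hy⟩ := hcap
  have hmem : ((0, y) : Pt d) ∈ OmegaSet UL UR := Or.inr (Or.inr ⟨rfl, hy⟩)
  have h1 := heq _ hmem
  rw [hcon.1, hcon.2, zero_mul, zero_mul, add_zero] at h1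
  exact (hwpos _ hmem).ne' h1
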